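/- arXiv:1710.05412 — 9 statements merged into one kernel-verified Lean document; each statement's English description precedes it below -/
import Mathlib

section
/- Let n ≥ 2 and let X be an n×n complex matrix that is not a scalar multiple of the identity matrix (i.e. X ≠ a·I for every a ∈ ℂ). If h₁ and h₂ are strict Hessenberg functions with h₁ ≠ h₂, then Hess(X,h₁) ≠ Hess(X,h₂) as sets of complete flags. -/
open Matrix

structure CompleteFlag (n : ℕ) where
  F : ℕ → Submodule ℂ (Fin n → ℂ)
  mono : Monotone F
  dim : ∀ i, i ≤ n → Module.finrank ℂ (F i) = i
  top : ∀ i, n ≤ i → F i = ⊤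

def IsHessFun (n : ℕ) (h : ℕ → ℕ) : Prop :=
  (∀ i j, 1 ≤ i → i ≤ j → j ≤ n → h i ≤ h j) ∧ (∀ i, 1 ≤ i → i ≤ n → h i ≤ n)

def IsStrictHessFun (n : ℕ) (h : ℕ → ℕ) : Prop :=
  IsHessFun n h ∧ ∀ i, 1 ≤ i → i ≤ n → i ≤ h i

def Hess (n : ℕ) (X : Matrix (Fin n) (Fin n) ℂ) (h : ℕ → ℕ) : Set (CompleteFlag n) :=
  {F | ∀ i, 1 ≤ i → i ≤ n → (F.F i).map X.mulVecLin ≤ F.F (h i)}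

def regNil (n : ℕ) : Matrix (Fin n) (Fin n) ℂ :=
  Matrix.of fun i j : Fin n => if i.1 + 1 = j.1 then 1 else 0

def w0 (n : ℕ) : Matrix (Fin n) (Fin n) ℂ :=
  Matrix.of fun i j : Fin n => if i.1 + j.1 + 1 = n then 1 else 0

def HessSpace (n : ℕ) (h : ℕ → ℕ) : Set (Matrix (Fin n) (Fin n) ℂ) :=
  {M | ∀ i j : Fin n, h (j.1 + 1) < i.1 + 1 → M i j = 0}

def flipSet (n : ℕ) (H : Set (Matrix (Fin n) (Fin n) ℂ)) : Set (Matrix (Fin n) (Fin n) ℂ) :=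
  (fun M => w0 n * Mᵀ * w0 n) '' H

def HessG (n : ℕ) (X : Matrix (Fin n) (Fin n) ℂ) (H : Set (Matrix (Fin n) (Fin n) ℂ)) :
    Set (GL (Fin n) ℂ) :=
  {g | (↑g⁻¹ : Matrix (Fin n) (Fin n) ℂ) * X * (↑g : Matrix (Fin n) (Fin n) ℂ) ∈ H}

open Submodule Module
section
variable {V : Type} [AddCommGroup V] [Module ℂ V] [FiniteDimensional ℂ V]

theorem hs_mem {A : Submodule ℂ V} {v x : V} :
    x ∈ A ⊔ span ℂ {v} ↔ ∃ c : ℂ, x - c • v ∈ A := by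
  rw [Submodule.mem_sup]
  constructor
  · rintro ⟨y, hy, z, hz, rfl⟩
    obtain ⟨c, rfl⟩ := Submodule.mem_span_singleton.1 hz
    exact ⟨c, by simpa using hy⟩
  · rintro ⟨c, hc⟩
    exact ⟨_, hc, c • v, Submodule.mem_span_singleton.2 ⟨c, rfl⟩, by abel⟩

theorem hs_le (A : Submodule ℂ V) (v : V) :
    finrank ℂ ↥(A ⊔ span ℂ {v}) ≤ finrank ℂ A + 1 := by
  have := Submodule.finrank_add_le_finrank_add_finrank A (span ℂ {v})
  have : finrank ℂ (span ℂ {v}) ≤ 1 := by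
    simpa using finrank_span_le_card (R := ℂ) ({v} : Set V)
  omega

theorem hs_eq {A : Submodule ℂ V} {v : V} (hv : v ∉ A) :
    finrank ℂ ↥(A ⊔ span ℂ {v}) = finrank ℂ A + 1 := by
  have h1 := hs_le A v
  have h2 : A < A ⊔ span ℂ {v} := by
    refine lt_of_le_of_ne le_sup_left fun h => hv ?_
    rw [h]; exact hs_mem.2 ⟨1, by simp⟩
  have := Submodule.finrank_lt_finrank_of_lt h2
  omega

theorem hs_self (A : Submodule ℂ V) (v : V) : v ∈ A ⊔ span ℂ {v} := hs_mem.2 ⟨1, by simp⟩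

theorem hs_sup_le {A B : Submodule ℂ V} {v : V} (h : A ≤ B) (hv : v ∈ B) :
    A ⊔ span ℂ {v} ≤ B := sup_le h (by simpa using hv)

theorem hs_ex {A B : Submodule ℂ V} (h : finrank ℂ A < finrank ℂ B) : ∃ x ∈ B, x ∉ A := by
  by_contra hc
  push Not at hc
  have := Submodule.finrank_mono (R := ℂ) (s := B) (t := A) hc
  omega

theorem hs_hyper (B : Submodule ℂ V) (p : V) (hp : p ∈ B) : ∀ (m : ℕ) (C : Submodule ℂ V),
    C ≤ B → p ∉ C → finrank ℂ C + 1 + m = finrank ℂ B →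
    ∃ H : Submodule ℂ V, C ≤ H ∧ H ≤ B ∧ p ∉ H ∧ finrank ℂ H + 1 = finrank ℂ B := by
  intro m
  induction m with
  | zero => intro C h1 h2 h3; exact ⟨C, le_rfl, h1, h2, h3⟩
  | succ m ih =>
    intro C h1 h2 h3
    obtain ⟨y, hyB, hy⟩ := hs_ex (A := C ⊔ span ℂ {p}) (B := B) (by have := hs_le C p; omega)
    have hyC : y ∉ C := fun h => hy (le_sup_left (a := C) h)
    obtain ⟨H, a, b, c, d⟩ := ih (C ⊔ span ℂ {y}) (hs_sup_le h1 hyB) (by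
      intro hm
      obtain ⟨t, ht⟩ := hs_mem.1 hm
      by_cases t0 : t = 0
      · subst t0; exact h2 (by simpa using ht)
      · apply hy
        refine hs_mem.2 ⟨t⁻¹, ?_⟩
        have := C.smul_mem (-t⁻¹) ht
        rw [smul_sub, smul_smul, neg_mul, inv_mul_cancel₀ t0] at this
        convert this using 1; module) (by rw [hs_eq hyC]; omega)
    exact ⟨H, le_sup_left.trans a, b, c, d⟩

theorem hs_hyper' {B C : Submodule ℂ V} {p : V} (hp : p ∈ B) (h1 : C ≤ B) (h2 : p ∉ C) :
    ∃ H : Submodule ℂ V, C ≤ H ∧ H ≤ B ∧ p ∉ H ∧ finrank ℂ H + 1 = finrank ℂ B := by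
  have h : C < B := lt_of_le_of_ne h1 fun h => h2 (h ▸ hp)
  have := Submodule.finrank_lt_finrank_of_lt h
  exact hs_hyper B p hp (finrank ℂ B - (finrank ℂ C + 1)) C h1 h2 (by omega)

theorem hs_chain (D : Submodule ℂ V) : ∀ (m : ℕ) (C : Submodule ℂ V), C ≤ D →
    finrank ℂ C + m = finrank ℂ D → ∃ F : ℕ → Submodule ℂ V, Monotone F ∧
      (∀ k ≤ finrank ℂ C, F k = C) ∧ (∀ k ≥ finrank ℂ D, F k = D) ∧
      (∀ k, finrank ℂ C ≤ k → k ≤ finrank ℂ D → finrank ℂ (F k) = k) := by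
  intro m
  induction m with
  | zero =>
    intro C h1 h2
    have : C = D := Submodule.eq_of_le_of_finrank_eq h1 h2
    subst this
    exact ⟨fun _ => C, fun _ _ _ => le_rfl, fun _ _ => rfl, fun _ _ => rfl,
      fun k a b => le_antisymm a b⟩
  | succ m ih =>
    intro C h1 h2
    obtain ⟨y, hyD, hy⟩ := hs_ex (A := C) (B := D) (by omega)
    have e := hs_eq hy
    obtain ⟨F, a, b, c, d⟩ := ih _ (hs_sup_le h1 hyD) (by rw [e]; omega)
    rw [e] at b d
    have hC : ∀ k, C ≤ F k := fun k => by
      have : C ≤ F 0 := by rw [b 0 (by omega)]; exact le_sup_left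
      exact this.trans (a (Nat.zero_le k))
    refine ⟨fun k => if k ≤ finrank ℂ C then C else F k, ?_, ?_, ?_, ?_⟩
    · intro k l hkl
      dsimp only
      split_ifs
      · exact le_rfl
      · exact hC l
      · omega
      · exact a hkl
    · intro k hk; simp [hk]
    · intro k hk
      beta_reduce; rw [if_neg (by omega)]; exact c k hk
    · intro k h3 h4
      beta_reduce
      by_cases hq : k ≤ finrank ℂ C
      · rw [if_pos hq]; omega
      · rw [if_neg hq]; exact d k (by omega) h4

variable (f : V →ₗ[ℂ] V)

theorem hs_eig {A B : Submodule ℂ V} (hA : ∀ x ∈ A, f x ∈ A) (hB : ∀ x ∈ B, f x ∈ B)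
    (hlt : finrank ℂ A < finrank ℂ B) :
    ∃ μ : ℂ, (∃ v ∈ B, v ∉ A ∧ f v - μ • v ∈ A) ∧
      ∃ p ∈ B, ∀ x ∈ B, ∀ y ∈ A, f x - μ • x + y ≠ p := by
  let g : B →ₗ[ℂ] B := f.restrict hB
  let A' : Submodule ℂ B := A.comap B.subtype
  have hA' : A' ≤ A'.comap g := fun x hx => hA _ hx
  let q : (B ⧸ A') →ₗ[ℂ] (B ⧸ A') := A'.mapQ A' g hA'
  obtain ⟨x, hxB, hxA⟩ := hs_ex hlt
  have : Nontrivial (B ⧸ A') := by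
    refine ⟨A'.mkQ ⟨x, hxB⟩, 0, fun h => hxA ?_⟩
    simpa [A'] using h
  obtain ⟨μ, hμ⟩ := Module.End.exists_eigenvalue q
  obtain ⟨w, hw⟩ := hμ.exists_hasEigenvector
  have hw1 := hw.apply_eq_smul
  have hw2 := hw.2
  refine ⟨μ, ?_, ?_⟩
  · obtain ⟨⟨v, hv⟩, rfl⟩ := A'.mkQ_surjective w
    refine ⟨v, hv, fun h => hw2 ?_, ?_⟩
    · simpa [A'] using h
    · have : A'.mkQ (g ⟨v, hv⟩ - μ • ⟨v, hv⟩) = 0 := by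
        rw [map_sub, map_smul, ← hw1]; simp [q]
      exact (Submodule.Quotient.mk_eq_zero A').1 this
  · by_contra hc
    simp only [not_exists, not_and, not_forall, ne_eq, not_not] at hc
    have hs : Function.Surjective (q - μ • (LinearMap.id : (B ⧸ A') →ₗ[ℂ] (B ⧸ A'))) := by
      intro z
      obtain ⟨⟨p, hp⟩, rfl⟩ := A'.mkQ_surjective z
      obtain ⟨x, hx, y, hy, h⟩ := hc p hp
      refine ⟨A'.mkQ ⟨x, hx⟩, ?_⟩
      have : A'.mkQ (g ⟨x, hx⟩ - μ • ⟨x, hx⟩ - ⟨p, hp⟩) = 0 := by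
        have h2 : f x - μ • x - p ∈ A := by
          rw [← h]; simpa using hy
        exact (Submodule.Quotient.mk_eq_zero A').2 h2
      rw [map_sub, sub_eq_zero, map_sub, map_smul] at this
      rw [← this]; simp [q]
    have hi : Function.Injective (q - μ • (LinearMap.id : (B ⧸ A') →ₗ[ℂ] (B ⧸ A'))) := LinearMap.injective_iff_surjective.2 hs
    exact hw2 (hi (by simp [hw1]))

theorem hs_inv_of {B H : Submodule ℂ V} {c : ℂ} (hHB : H ≤ B)
    (h : ∀ x ∈ B, f x - c • x ∈ H) : ∀ x ∈ H, f x ∈ H := by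
  intro x hx
  have := H.add_mem (h x (hHB hx)) (H.smul_mem c hx)
  simpa using this

theorem hs_inv_add {A : Submodule ℂ V} {v : V} {c : ℂ} (hA : ∀ x ∈ A, f x ∈ A)
    (h : f v - c • v ∈ A) : ∀ x ∈ A ⊔ span ℂ {v}, f x ∈ A ⊔ span ℂ {v} := by
  intro x hx
  obtain ⟨t, ht⟩ := hs_mem.1 hx
  refine hs_mem.2 ⟨t * c, ?_⟩
  have := A.add_mem (hA _ ht) (A.smul_mem t h)
  rw [map_sub, map_smul] at this
  convert this using 1; module

theorem hs_smul {A : Submodule ℂ V} {v : V} {c : ℂ} (h : c • v ∈ A) (hv : v ∉ A) : c = 0 := by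
  by_contra h0
  exact hv ((Submodule.smul_mem_iff A h0).1 h)

theorem hs_lower {A B : Submodule ℂ V} (hA : ∀ x ∈ A, f x ∈ A) (hB : ∀ x ∈ B, f x ∈ B)
    (hAB : A ≤ B) (hd : finrank ℂ A + 3 ≤ finrank ℂ B)
    (hns : ∀ c : ℂ, ∃ x ∈ B, f x - c • x ∉ A) :
    ∃ A' : Submodule ℂ V, A ≤ A' ∧ A' ≤ B ∧ finrank ℂ A' = finrank ℂ A + 1 ∧
      (∀ x ∈ A', f x ∈ A') ∧ ∀ c : ℂ, ∃ x ∈ B, f x - c • x ∉ A' := by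
  obtain ⟨μ, ⟨v, hvB, hvA, hv⟩, -⟩ := hs_eig f hA hB (by omega)
  by_cases h1 : ∀ c : ℂ, ∃ x ∈ B, f x - c • x ∉ A ⊔ span ℂ {v}
  · exact ⟨_, le_sup_left, hs_sup_le hAB hvB, hs_eq hvA, hs_inv_add f hA hv, h1⟩
  push Not at h1
  obtain ⟨c, hc⟩ := h1
  have e1 := hs_eq hvA
  obtain ⟨w, hwB, hw1, hw⟩ : ∃ w ∈ B, w ∉ A ⊔ span ℂ {v} ∧ f w - c • w ∈ A := by
    obtain ⟨y, hyB, hy⟩ := hs_ex (A := A ⊔ span ℂ {v}) (B := B) (by omega)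
    have e2 := hs_eq hy
    obtain ⟨z, hzB, hz⟩ := hs_ex (A := A ⊔ span ℂ {v} ⊔ span ℂ {y}) (B := B) (by omega)
    obtain ⟨α, hα⟩ := hs_mem.1 (hc y hyB)
    obtain ⟨β, hβ⟩ := hs_mem.1 (hc z hzB)
    by_cases α0 : α = 0
    · exact ⟨y, hyB, hy, by simpa [α0] using hα⟩
    · refine ⟨z - (β / α) • y, B.sub_mem hzB (B.smul_mem _ hyB), fun h => hz (hs_mem.2 ⟨_, h⟩), ?_⟩
      have := A.sub_mem hβ (A.smul_mem (β / α) hα)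
      rw [smul_sub, smul_smul (β / α) α, div_mul_cancel₀ _ α0] at this
      rw [map_sub, map_smul]
      convert this using 1; module
  have hwA : w ∉ A := fun h => hw1 (le_sup_left (a := A) h)
  refine ⟨_, le_sup_left, hs_sup_le hAB hwB, hs_eq hwA, hs_inv_add f hA hw, ?_⟩
  by_contra h2
  push Not at h2
  obtain ⟨d, hd2⟩ := h2
  have e3 := hs_eq hw1
  obtain ⟨z, hzB, hz⟩ := hs_ex (A := A ⊔ span ℂ {v} ⊔ span ℂ {w}) (B := B) (by omega)
  have hcd : d - c = 0 := by
    refine hs_smul ?_ hz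
    have m1 : f z - c • z ∈ A ⊔ span ℂ {v} ⊔ span ℂ {w} := le_sup_left (a := A ⊔ span ℂ {v}) (hc z hzB)
    have m2 : f z - d • z ∈ A ⊔ span ℂ {v} ⊔ span ℂ {w} :=
      sup_le_sup_right (le_sup_left (a := A)) _ (hd2 z hzB)
    convert Submodule.sub_mem _ m1 m2 using 1; module
  obtain rfl := sub_eq_zero.1 hcd
  obtain ⟨x, hxB, hx⟩ := hns d
  apply hx
  obtain ⟨t, ht⟩ := hs_mem.1 (hd2 x hxB)
  have : t = 0 := by
    refine hs_smul (v := w) ?_ hw1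
    convert Submodule.sub_mem _ (hc x hxB) (le_sup_left (a := A) (b := span ℂ {v}) ht) using 1; module
  simpa [this] using ht

theorem hs_upper {A B : Submodule ℂ V} (hA : ∀ x ∈ A, f x ∈ A) (hB : ∀ x ∈ B, f x ∈ B)
    (hAB : A ≤ B) (hd : finrank ℂ A + 3 ≤ finrank ℂ B)
    (hns : ∀ c : ℂ, ∃ x ∈ B, f x - c • x ∉ A) :
    ∃ H : Submodule ℂ V, A ≤ H ∧ H ≤ B ∧ finrank ℂ H + 1 = finrank ℂ B ∧
      (∀ x ∈ H, f x ∈ H) ∧ ∀ c : ℂ, ∃ x ∈ H, f x - c • x ∉ A := by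
  obtain ⟨μ, -, p, hpB, hp⟩ := hs_eig f hA hB (by omega)
  obtain ⟨H, hRH, hHB, hpH, hH⟩ := hs_hyper' (C := B.map (f - μ • LinearMap.id) ⊔ A) hpB
    (by
      refine sup_le ?_ hAB
      rintro _ ⟨x, hx, rfl⟩
      exact B.sub_mem (hB x hx) (B.smul_mem _ hx))
    (by
      intro h
      obtain ⟨_, ⟨x, hx, rfl⟩, y, hy, h⟩ := Submodule.mem_sup.1 h
      exact hp x hx y hy h)
  have hAH : A ≤ H := le_sup_right.trans hRH
  have hfH : ∀ x ∈ B, f x - μ • x ∈ H := fun x hx =>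
    hRH (Submodule.mem_sup_left ⟨x, hx, rfl⟩)
  by_cases h1 : ∀ c : ℂ, ∃ x ∈ H, f x - c • x ∉ A
  · exact ⟨H, hAH, hHB, hH, hs_inv_of f hHB hfH, h1⟩
  push Not at h1
  obtain ⟨c, hc⟩ := h1
  have eB : H ⊔ span ℂ {p} = B := Submodule.eq_of_le_of_finrank_eq (hs_sup_le hHB hpB)
    (by rw [hs_eq hpH, hH])
  have hu : f p - c • p ∈ B := B.sub_mem (hB p hpB) (B.smul_mem _ hpB)
  have hBu : ∀ x ∈ B, f x - c • x ∈ A ⊔ span ℂ {f p - c • p} := by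
    intro x hx
    rw [← eB] at hx
    obtain ⟨t, ht⟩ := hs_mem.1 hx
    refine hs_mem.2 ⟨t, ?_⟩
    convert hc _ ht using 1
    rw [map_sub, map_smul]; module
  have e1 := hs_le A (f p - c • p)
  obtain ⟨r, hrH, hr⟩ := hs_ex (A := A ⊔ span ℂ {f p - c • p}) (B := H) (by omega)
  obtain ⟨K, hK1, hKB, hrK, hK⟩ := hs_hyper' (hHB hrH) (hs_sup_le hAB hu) hr
  have hAK : A ≤ K := le_sup_left.trans hK1
  refine ⟨K, hAK, hKB, hK, hs_inv_of f hKB fun x hx => hK1 (hBu x hx), ?_⟩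
  by_contra h2
  push Not at h2
  obtain ⟨d, hd2⟩ := h2
  have eB2 : K ⊔ span ℂ {r} = B := Submodule.eq_of_le_of_finrank_eq (hs_sup_le hKB (hHB hrH))
    (by rw [hs_eq hrK, hK])
  obtain ⟨x, ⟨hxH, hxK⟩, hxA⟩ := hs_ex (A := A) (B := H ⊓ K) (by
    have s1 := Submodule.finrank_sup_add_finrank_inf_eq H K
    have s2 := Submodule.finrank_mono (sup_le hHB hKB)
    omega)
  have hcd : d - c = 0 := by
    refine hs_smul ?_ hxA
    convert A.sub_mem (hc x hxH) (hd2 x hxK) using 1; module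
  obtain rfl := sub_eq_zero.1 hcd
  obtain ⟨x, hxB, hx⟩ := hns d
  apply hx
  rw [← eB2] at hxB
  obtain ⟨t, ht⟩ := hs_mem.1 hxB
  convert A.add_mem (hd2 _ ht) (A.smul_mem t (hc r hrH)) using 1
  rw [map_sub, map_smul]; module

theorem hs_noneig {A B : Submodule ℂ V}
    (hA : ∀ x ∈ A, f x ∈ A)
    (hns : ∀ c : ℂ, ∃ x ∈ B, f x - c • x ∉ A) :
    ∃ v ∈ B, v ∉ A ∧ f v ∉ A ⊔ span ℂ {v} := by
  by_contra hcon
  push Not at hcon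
  have hcon' : ∀ v ∈ B, ∃ c : ℂ, f v - c • v ∈ A := by
    intro v hv
    by_cases h : v ∈ A
    · exact ⟨0, by simpa using hA v h⟩
    · exact hs_mem.1 (hcon v hv h)
  obtain ⟨y, hyB, hy⟩ : ∃ y ∈ B, y ∉ A := by
    obtain ⟨x, hx, hx2⟩ := hns 0
    exact ⟨x, hx, fun h => hx2 (by simpa using hA x h)⟩
  obtain ⟨c, hc⟩ := hcon' y hyB
  obtain ⟨x, hxB, hx⟩ := hns c
  apply hx
  by_cases hxy : x ∈ A ⊔ span ℂ {y}
  · obtain ⟨t, ht⟩ := hs_mem.1 hxy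
    convert A.add_mem (A.sub_mem (hA _ ht) (A.smul_mem c ht)) (A.smul_mem t hc) using 1
    rw [map_sub, map_smul]; module
  · obtain ⟨d, hd⟩ := hcon' x hxB
    obtain ⟨e, he⟩ := hcon' (x + y) (B.add_mem hxB hyB)
    have key : (e - d) • x - (c - e) • y ∈ A := by
      rw [map_add] at he
      convert A.sub_mem (A.add_mem hd hc) he using 1; module
    have h1 : e - d = 0 := hs_smul (hs_mem.2 ⟨_, key⟩) hxy
    rw [h1, zero_smul, zero_sub, A.neg_mem_iff] at key
    have h2 := hs_smul key hy
    have : c = d := by linear_combination h1 + h2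
    rwa [this]

theorem hs_main : ∀ (m : ℕ) (A B : Submodule ℂ V) (i j : ℕ), (∀ x ∈ A, f x ∈ A) →
    (∀ x ∈ B, f x ∈ B) → A ≤ B → (∀ c : ℂ, ∃ x ∈ B, f x - c • x ∉ A) →
    finrank ℂ A + m = finrank ℂ B → finrank ℂ A < i → i < j → j ≤ finrank ℂ B →
    ∃ F : ℕ → Submodule ℂ V, Monotone F ∧
      (∀ k ≤ finrank ℂ A, F k = A) ∧ (∀ k ≥ finrank ℂ B, F k = B) ∧
      (∀ k, finrank ℂ A ≤ k → k ≤ finrank ℂ B → finrank ℂ (F k) = k) ∧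
      (∀ k, k < i ∨ j ≤ k → ∀ x ∈ F k, f x ∈ F k) ∧ ∃ v ∈ F i, f v ∉ F (j - 1) := by
  intro m
  induction m with
  | zero => intros; omega
  | succ m ih =>
    intro A B i j hA hB hAB hns hm hi hij hj
    by_cases c1 : finrank ℂ A + 1 < i
    · obtain ⟨A', h1, h2, h3, h4, h5⟩ := hs_lower f hA hB hAB (by omega) hns
      obtain ⟨F, a, b, c, d, e, g⟩ := ih A' B i j h4 hB h2 h5 (by omega) (by omega) hij hj
      rw [h3] at b d
      have hC : ∀ k, A ≤ F k := fun k => by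
        have : A ≤ F 0 := by rw [b 0 (by omega)]; exact h1
        exact this.trans (a (Nat.zero_le k))
      refine ⟨fun k => if k ≤ finrank ℂ A then A else F k, ?_, ?_, ?_, ?_, ?_, ?_⟩
      · intro k l hkl
        dsimp only
        split_ifs
        · exact le_rfl
        · exact hC l
        · omega
        · exact a hkl
      · intro k hk; simp [hk]
      · intro k hk
        beta_reduce; rw [if_neg (by omega)]; exact c k hk
      · intro k h3 h4
        beta_reduce
        by_cases hq : k ≤ finrank ℂ A
        · rw [if_pos hq]; omega
        · rw [if_neg hq]; exact d k (by omega) h4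
      · intro k hk
        dsimp only
        split_ifs
        · exact hA
        · exact e k hk
      · beta_reduce; rw [if_neg (by omega), if_neg (by omega)]; exact g
    by_cases c2 : j < finrank ℂ B
    · obtain ⟨H, h1, h2, h3, h4, h5⟩ := hs_upper f hA hB hAB (by omega) hns
      obtain ⟨F, a, b, c, d, e, g⟩ := ih A H i j hA h4 h1 h5 (by omega) (by omega) hij (by omega)
      have hC : ∀ k, F k ≤ B := fun k => by
        have := c (k + finrank ℂ H) (by omega)
        exact (a (Nat.le_add_right k _)).trans (this.le.trans h2)
      refine ⟨fun k => if finrank ℂ B ≤ k then B else F k, ?_, ?_, ?_, ?_, ?_, ?_⟩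
      · intro k l hkl
        dsimp only
        split_ifs
        · exact le_rfl
        · omega
        · exact hC k
        · exact a hkl
      · intro k hk
        beta_reduce; rw [if_neg (by omega)]; exact b k hk
      · intro k hk; exact if_pos hk
      · intro k h3 h4
        beta_reduce
        by_cases hq : finrank ℂ B ≤ k
        · rw [if_pos hq]; omega
        · rw [if_neg hq]; exact d k (by omega) (by omega)
      · intro k hk
        dsimp only
        split_ifs
        · exact hB
        · exact e k hk
      · beta_reduce; rw [if_neg (by omega), if_neg (by omega)]; exact g
    · obtain ⟨v, hvB, hvA, hv⟩ := hs_noneig f hA hns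
      obtain ⟨H, h1, h2, h3, h4⟩ := hs_hyper' (hB v hvB) (hs_sup_le hAB hvB) hv
      have e1 := hs_eq hvA
      have e2 := Submodule.finrank_mono h1
      obtain ⟨F, a, b, c, d⟩ := hs_chain H (finrank ℂ H - (finrank ℂ A + 1)) _ h1 (by omega)
      rw [e1] at b d
      have hC : ∀ k, A ≤ F k := fun k => by
        have : A ≤ F 0 := by rw [b 0 (by omega)]; exact le_sup_left
        exact this.trans (a (Nat.zero_le k))
      have hC2 : ∀ k, F k ≤ B := fun k => by
        have := c (k + finrank ℂ H) (by omega)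
        exact (a (Nat.le_add_right k _)).trans (this.le.trans h2)
      refine ⟨fun k => if k ≤ finrank ℂ A then A else if finrank ℂ B ≤ k then B else F k,
        ?_, ?_, ?_, ?_, ?_, ?_⟩
      · intro k l hkl
        dsimp only
        split_ifs
        all_goals first | exact le_rfl | exact hAB | exact hC _ | exact hC2 _ | exact a hkl | omega
      · intro k hk; simp [hk]
      · intro k hk
        beta_reduce; rw [if_neg (by omega), if_pos hk]
      · intro k h3 h4
        beta_reduce
        by_cases hq : k ≤ finrank ℂ A
        · rw [if_pos hq]; omega
        by_cases hq2 : finrank ℂ B ≤ k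
        · rw [if_neg hq, if_pos hq2]; omega
        · rw [if_neg hq, if_neg hq2]; exact d k (by omega) (by omega)
      · intro k hk
        dsimp only
        split_ifs
        · exact hA
        · exact hB
        · omega
      · refine ⟨v, ?_, ?_⟩
        · beta_reduce; rw [if_neg (by omega), if_neg (by omega), b i (by omega)]
          exact hs_self A v
        · beta_reduce; rw [if_neg (by omega), if_neg (by omega), c _ (by omega)]
          exact h3
end

theorem hs_aux {n : ℕ} 
    (X : Matrix (Fin n) (Fin n) ℂ)
    (hX : ∀ a : ℂ, X ≠ a • (1 : Matrix (Fin n) (Fin n) ℂ))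
    (h₁ h₂ : ℕ → ℕ) (hh₁ : IsStrictHessFun n h₁) (hh₂ : IsStrictHessFun n h₂)
    (i : ℕ) (hi : 1 ≤ i) (hin : i ≤ n) (hlt : h₁ i < h₂ i) :
    Hess n X h₁ ≠ Hess n X h₂ := by
  have ft : finrank ℂ (⊤ : Submodule ℂ (Fin n → ℂ)) = n := by simp
  have fb : finrank ℂ (⊥ : Submodule ℂ (Fin n → ℂ)) = 0 := by simp
  have hih := hh₁.2 i hi hin
  obtain ⟨F, a, b, c, d, e, v, hv, hfv⟩ := hs_main X.mulVecLin n ⊥ ⊤ i (h₂ i) (by simp) (by simp)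
    le_top (by
      intro c
      by_contra hc
      push Not at hc
      refine hX c ?_
      apply Matrix.ext_of_mulVec_single
      intro k
      have := hc (Pi.single k 1) trivial
      rw [Submodule.mem_bot, sub_eq_zero] at this
      rw [Matrix.smul_mulVec, Matrix.one_mulVec]
      exact this) (by omega) (by omega) (by omega) (by rw [ft]; exact hh₂.1.2 i hi hin)
  rw [ft] at c d
  rw [fb] at d
  intro heq
  let G : CompleteFlag n := ⟨F, a, fun k hk => d k (Nat.zero_le _) hk, c⟩
  have hG : G ∈ Hess n X h₂ := by
    intro k hk hkn
    rintro _ ⟨x, hx, rfl⟩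
    change _ ∈ F _
    by_cases hki : k < i
    · exact a (hh₂.2 k hk hkn) (e k (Or.inl hki) x hx)
    · have h1 : h₂ i ≤ h₂ k := hh₂.1.1 i k hi (by omega) hkn
      exact e (h₂ k) (Or.inr h1) x (a (hh₂.2 k hk hkn) hx)
  rw [← heq] at hG
  exact hfv (a (by omega) (hG i hi hin ⟨v, hv, rfl⟩))

/-- If `X` is not a scalar multiple of the identity and `h₁, h₂` are strict
Hessenberg functions differing somewhere on `{1,…,n}`, then `Hess(X,h₁) ≠ Hess(X,h₂)`. -/
theorem hess_ne_of_strict_hess_fun_ne {n : ℕ} (hn : 2 ≤ n)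
    (X : Matrix (Fin n) (Fin n) ℂ)
    (hX : ∀ a : ℂ, X ≠ a • (1 : Matrix (Fin n) (Fin n) ℂ))
    (h₁ h₂ : ℕ → ℕ) (hh₁ : IsStrictHessFun n h₁) (hh₂ : IsStrictHessFun n h₂)
    (hne : ∃ i, 1 ≤ i ∧ i ≤ n ∧ h₁ i ≠ h₂ i) :
    Hess n X h₁ ≠ Hess n X h₂ := by
  obtain ⟨i, hi, hin, h⟩ := hne
  rcases lt_or_gt_of_ne h with h | h
  · exact hs_aux X hX h₁ h₂ hh₁ hh₂ i hi hin h
  · exact (hs_aux X hX h₂ h₁ hh₂ hh₁ i hi hin h).symm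
end

section
/- Let n ≥ 2 and let X be an n×n complex matrix that is not a scalar multiple of the identity matrix. Then for every pair of indices 1 ≤ i < j ≤ n there exists a complete flag F in ℂⁿ such that for every strict Hessenberg function h, F ∈ Hess(X,h) if and only if h(i) ≥ j. -/
open Matrix

open Module Submodule

lemma exists_notMem_of_finrank_lt {V : Type*} [AddCommGroup V] [Module ℂ V] [FiniteDimensional ℂ V]
    {P Q : Submodule ℂ V} (h : finrank ℂ Q < finrank ℂ P) : ∃ x ∈ P, x ∉ Q := by
  by_contra! hc
  exact absurd (Submodule.finrank_mono (show P ≤ Q from hc)) (by omega)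

lemma finrank_span_sing_le {V : Type*} [AddCommGroup V] [Module ℂ V] (v : V) :
    finrank ℂ (span ℂ {v}) ≤ 1 := by
  simpa using finrank_span_le_card (R := ℂ) ({v} : Set V)

lemma exists_line {V : Type*} [AddCommGroup V] [Module ℂ V] [FiniteDimensional ℂ V]
    (hd : 3 ≤ finrank ℂ V) (T : V →ₗ[ℂ] V) (hT : ∀ c : ℂ, ∃ x, T x - c • x ≠ 0) :
    ∃ w : V, w ≠ 0 ∧ (∃ μ : ℂ, T w = μ • w) ∧ ∀ c : ℂ, ∃ x, T x - c • x ∉ span ℂ {w} := by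
  have : Nontrivial V := Module.nontrivial_of_finrank_pos (R := ℂ) (by omega)
  obtain ⟨μ, hμ⟩ := Module.End.exists_eigenvalue T
  obtain ⟨w, hw⟩ := hμ.exists_hasEigenvector
  by_cases hs : ∀ c : ℂ, ∃ x, T x - c • x ∉ span ℂ {w}
  · exact ⟨w, hw.2, ⟨μ, hw.apply_eq_smul⟩, hs⟩
  push Not at hs
  obtain ⟨c, hc⟩ := hs
  have h1 : LinearMap.range (T - c • LinearMap.id) ≤ span ℂ {w} := by
    rintro _ ⟨x, rfl⟩
    simpa using hc x
  have h2 := Submodule.finrank_mono h1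
  have h3 := LinearMap.finrank_range_add_finrank_ker (T - c • LinearMap.id)
  have h4 := finrank_span_sing_le w
  obtain ⟨w', hw', hn⟩ := exists_notMem_of_finrank_lt
    (P := LinearMap.ker (T - c • LinearMap.id)) (Q := span ℂ {w}) (by omega)
  have hTw' : T w' = c • w' := by
    simpa [sub_eq_zero] using hw'
  refine ⟨w', fun h => hn (by simp [h]), ⟨c, hTw'⟩, ?_⟩
  intro d
  by_contra! hd'
  by_cases hcd : d = c
  · subst hcd
    obtain ⟨x, hx⟩ := hT d
    obtain ⟨a, ha⟩ := mem_span_singleton.1 (hd' x)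
    have hb := hc x
    rw [← ha] at hb
    have ha0 : a ≠ 0 := by
      rintro rfl
      exact hx (by simp [← ha])
    exact hn ((Submodule.smul_mem_iff _ ha0).1 hb)
  · have htop : (⊤ : Submodule ℂ V) ≤ span ℂ {w} ⊔ span ℂ {w'} := by
      intro x _
      have : (c - d) • x ∈ span ℂ {w} ⊔ span ℂ {w'} := by
        have e : (c - d) • x = (T x - d • x) - (T x - c • x) := by
          rw [sub_smul]; abel
        rw [e]
        exact sub_mem (mem_sup_right (hd' x)) (mem_sup_left (hc x))
      exact (Submodule.smul_mem_iff _ (sub_ne_zero.2 (Ne.symm hcd))).1 this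
    have h5 := Submodule.finrank_mono htop
    have h6 := finrank_span_sing_le w'
    have h7 := Submodule.finrank_add_le_finrank_add_finrank (span ℂ {w}) (span ℂ {w'})
    rw [finrank_top] at h5
    omega

lemma exists_hyper {V : Type*} [AddCommGroup V] [Module ℂ V] [FiniteDimensional ℂ V]
    (hd : 3 ≤ finrank ℂ V) (T : V →ₗ[ℂ] V) (hT : ∀ c : ℂ, ∃ x, T x - c • x ≠ 0) :
    ∃ H : Submodule ℂ V, finrank ℂ H + 1 = finrank ℂ V ∧ (∀ x ∈ H, T x ∈ H) ∧
      ∀ c : ℂ, ∃ x ∈ H, T x - c • x ≠ 0 := by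
  have : Nontrivial V := Module.nontrivial_of_finrank_pos (R := ℂ) (by omega)
  obtain ⟨μ, hμ⟩ := Module.End.exists_eigenvalue T
  obtain ⟨w, hw⟩ := hμ.exists_hasEigenvector
  have hTw : T w = μ • w := hw.apply_eq_smul
  have hns : ¬ Function.Surjective ((T - μ • LinearMap.id : V →ₗ[ℂ] V)) := by
    rw [← LinearMap.injective_iff_surjective]
    intro hinj
    exact hw.2 (hinj (by simp [hTw]))
  obtain ⟨y, hy⟩ : ∃ y, y ∉ LinearMap.range ((T - μ • LinearMap.id : V →ₗ[ℂ] V)) := by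
    by_contra! h
    exact hns fun y => h y
  obtain ⟨f, hfy, hf⟩ := Submodule.exists_le_ker_of_notMem hy
  have hfr : finrank ℂ (LinearMap.ker f) + 1 = finrank ℂ V :=
    Module.Dual.finrank_ker_add_one_of_ne_zero (f := f) (by rintro rfl; simp at hfy)
  have hfT : ∀ x, f (T x) = μ * f x := by
    intro x
    have := hf ⟨x, rfl⟩
    simpa [sub_eq_zero] using this
  by_cases hs : ∀ c : ℂ, ∃ x ∈ LinearMap.ker f, T x - c • x ≠ 0
  · refine ⟨_, hfr, ?_, hs⟩
    intro x hx
    rw [LinearMap.mem_ker] at hx ⊢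
    rw [hfT, hx, mul_zero]
  push Not at hs
  obtain ⟨c, hc⟩ := hs
  set v := T y - c • y with hv
  have hall : ∀ x, T x - c • x = (f x / f y) • v := by
    intro x
    have := hc (x - (f x / f y) • y) (by simp [hfy])
    rw [← sub_eq_zero, ← this, hv]
    simp only [map_sub, map_smul]
    module
  obtain ⟨h, hhf, hhv⟩ := exists_notMem_of_finrank_lt
    (P := LinearMap.ker f) (Q := span ℂ {v}) (by have := finrank_span_sing_le v; omega)
  obtain ⟨g, hgh, hg⟩ := Submodule.exists_le_ker_of_notMem hhv
  have hgr : finrank ℂ (LinearMap.ker g) + 1 = finrank ℂ V :=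
    Module.Dual.finrank_ker_add_one_of_ne_zero (f := g) (by rintro rfl; simp at hgh)
  have hgv : v ∈ LinearMap.ker g := hg (mem_span_singleton_self v)
  refine ⟨LinearMap.ker g, hgr, ?_, ?_⟩
  · intro x hx
    have : T x = (f x / f y) • v + c • x := by rw [← hall]; abel
    rw [this]
    exact add_mem (smul_mem _ _ hgv) (smul_mem _ _ hx)
  · intro d
    by_contra! hd'
    have h5 := Submodule.finrank_sup_add_finrank_inf_eq (LinearMap.ker f) (LinearMap.ker g)
    have h6 := Submodule.finrank_le (LinearMap.ker f ⊔ LinearMap.ker g)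
    obtain ⟨z, hz, hz0⟩ := exists_notMem_of_finrank_lt
      (P := LinearMap.ker f ⊓ LinearMap.ker g) (Q := (⊥ : Submodule ℂ V))
      (by rw [finrank_bot]; omega)
    have e1 := hc z hz.1
    have e2 := hd' z hz.2
    have e3 : (c - d) • z = 0 := by
      rw [sub_smul, ← sub_eq_zero.1 e1, ← sub_eq_zero.1 e2, sub_self]
    have hcd : c = d := by
      rcases smul_eq_zero.1 e3 with h | h
      · exact sub_eq_zero.1 h
      · exact absurd (by simpa using h) hz0
    subst hcd
    have e4 := hd' (y - (g y / g h) • h) (by simp [hgh])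
    have e5 := hc h hhf
    have hv0 : v = 0 := by
      have : v = (T (y - (g y / g h) • h) - c • (y - (g y / g h) • h)) +
          (g y / g h) • (T h - c • h) := by
        rw [hv]; simp only [map_sub, map_smul]; module
      rw [this, e4, e5]; simp
    obtain ⟨x, hx⟩ := hT c
    exact hx (by rw [hall, hv0, smul_zero])

structure IsFlag {V : Type*} [AddCommGroup V] [Module ℂ V] (n : ℕ)
    (F : ℕ → Submodule ℂ V) : Prop where
  mono : Monotone F
  dim : ∀ i, i ≤ n → finrank ℂ (F i) = i
  top : ∀ i, n ≤ i → F i = ⊤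

def upFlag {V : Type*} [AddCommGroup V] [Module ℂ V] (w : V)
    (F : ℕ → Submodule ℂ (V ⧸ span ℂ {w})) : ℕ → Submodule ℂ V
  | 0 => ⊥
  | k + 1 => (F k).comap (span ℂ {w}).mkQ

lemma finrank_quot {V : Type*} [AddCommGroup V] [Module ℂ V] [FiniteDimensional ℂ V] {w : V}
    (hw : w ≠ 0) : finrank ℂ (V ⧸ span ℂ {w}) + 1 = finrank ℂ V := by
  have := Submodule.finrank_quotient_add_finrank (span ℂ {w})
  rwa [finrank_span_singleton hw] at this

lemma upFlag_isFlag {V : Type*} [AddCommGroup V] [Module ℂ V] [FiniteDimensional ℂ V] {w : V}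
    (hw : w ≠ 0) {n : ℕ} {F : ℕ → Submodule ℂ (V ⧸ span ℂ {w})} (hF : IsFlag n F) :
    IsFlag (n + 1) (upFlag w F) := by
  refine ⟨monotone_nat_of_le_succ ?_, ?_, ?_⟩
  · rintro (_ | k)
    · exact bot_le
    · exact Submodule.comap_mono (hF.mono (Nat.le_succ k))
  · rintro (_ | k) hk
    · exact finrank_bot ℂ V
    · have h1 := hF.dim k (by omega)
      have h2 := LinearMap.finrank_range_add_finrank_ker
        ((span ℂ {w}).mkQ.domRestrict ((F k).comap (span ℂ {w}).mkQ))
      have h3 : LinearMap.range ((span ℂ {w}).mkQ.domRestrict ((F k).comap (span ℂ {w}).mkQ))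
          = F k := by
        rw [LinearMap.range_domRestrict, Submodule.map_comap_eq_of_surjective (mkQ_surjective _)]
      have h4 : finrank ℂ (LinearMap.ker
          ((span ℂ {w}).mkQ.domRestrict ((F k).comap (span ℂ {w}).mkQ))) = 1 := by
        rw [LinearMap.ker_domRestrict, Submodule.ker_mkQ]
        have hle : span ℂ {w} ≤ (F k).comap (span ℂ {w}).mkQ := by
          intro x hx
          have : (span ℂ {w}).mkQ x = 0 := by simpa using hx
          rw [mem_comap, this]
          exact zero_mem _
        exact (Submodule.submoduleOfEquivOfLe hle).finrank_eq.trans (finrank_span_singleton hw)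
      rw [h3, h4, h1] at h2
      exact h2.symm
  · rintro (_ | k) hk
    · omega
    · simp [upFlag, hF.top k (by omega)]

def hypFlag {V : Type*} [AddCommGroup V] [Module ℂ V] (H : Submodule ℂ V) (n : ℕ)
    (F : ℕ → Submodule ℂ H) (k : ℕ) : Submodule ℂ V :=
  if k ≤ n then (F k).map H.subtype else ⊤

lemma hypFlag_isFlag {V : Type*} [AddCommGroup V] [Module ℂ V] [FiniteDimensional ℂ V]
    {H : Submodule ℂ V} {n : ℕ} (hV : finrank ℂ V = n + 1)
    {F : ℕ → Submodule ℂ H} (hF : IsFlag n F) :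
    IsFlag (n + 1) (hypFlag H n F) := by
  refine ⟨?_, ?_, ?_⟩
  · intro a b hab
    unfold hypFlag
    by_cases hb : b ≤ n
    · rw [if_pos hb, if_pos (hab.trans hb)]
      exact Submodule.map_mono (hF.mono hab)
    · rw [if_neg hb]
      exact le_top
  · intro k hk
    unfold hypFlag
    by_cases h : k ≤ n
    · rw [if_pos h, Submodule.finrank_map_subtype_eq, hF.dim k h]
    · rw [if_neg h, finrank_top]; omega
  · intro k hk
    unfold hypFlag
    rw [if_neg (by omega)]

lemma exists_isFlag (n : ℕ) : ∀ (V : Type) [AddCommGroup V] [Module ℂ V] [FiniteDimensional ℂ V],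
    finrank ℂ V = n → ∃ F : ℕ → Submodule ℂ V, IsFlag n F := by
  induction n with
  | zero =>
    intro V _ _ _ hV
    refine ⟨fun _ => ⊤, fun _ _ _ => le_rfl, ?_, fun _ _ => rfl⟩
    intro i hi
    rw [finrank_top]; omega
  | succ n ih =>
    intro V _ _ _ hV
    have : Nontrivial V := Module.nontrivial_of_finrank_pos (R := ℂ) (by omega)
    obtain ⟨w, hw⟩ := exists_ne (0 : V)
    have := finrank_quot hw
    obtain ⟨F, hF⟩ := ih (V ⧸ span ℂ {w}) (by omega)
    exact ⟨_, upFlag_isFlag hw hF⟩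

lemma exists_noneigen {V : Type*} [AddCommGroup V] [Module ℂ V]
    (T : V →ₗ[ℂ] V) (hT : ∀ c : ℂ, ∃ x, T x - c • x ≠ 0) :
    ∃ v : V, v ≠ 0 ∧ T v ∉ span ℂ {v} := by
  by_contra! hc
  obtain ⟨a, ha⟩ := LinearMap.exists_eq_smul_id_of_forall_notLinearIndependent (f := T) (by
    intro v hli
    have h0 : v ≠ 0 := hli.ne_zero 0
    obtain ⟨a, ha⟩ := mem_span_singleton.1 (hc v h0)
    rw [LinearIndependent.pair_iff] at hli
    have := (hli a (-1) (by rw [ha]; simp)).2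
    norm_num at this)
  obtain ⟨x, hx⟩ := hT a
  exact hx (by simp [ha])

theorem main_aux (n : ℕ) : ∀ (V : Type) [AddCommGroup V] [Module ℂ V] [FiniteDimensional ℂ V],
    finrank ℂ V = n → ∀ (T : V →ₗ[ℂ] V), (∀ c : ℂ, ∃ x, T x - c • x ≠ 0) →
    ∀ i j : ℕ, i + 1 < j → j ≤ n →
    ∃ F : ℕ → Submodule ℂ V, IsFlag n F ∧ (∀ k ≤ i, ∀ x ∈ F k, T x ∈ F k) ∧
      (∀ k ≥ j, ∀ x ∈ F k, T x ∈ F k) ∧ ∃ x ∈ F (i + 1), T x ∉ F (j - 1) := by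
  induction n with
  | zero => intros; omega
  | succ n ih =>
    intro V _ _ _ hV T hT i j hij hj
    rcases Nat.eq_zero_or_pos i with hi | hi
    · by_cases hjn : j = n + 1
      · subst hi hjn
        obtain ⟨v, hv0, hv⟩ := exists_noneigen T hT
        obtain ⟨f, hfy, hf⟩ := Submodule.exists_le_ker_of_notMem hv
        have hfr : finrank ℂ (LinearMap.ker f) + 1 = finrank ℂ V :=
          Module.Dual.finrank_ker_add_one_of_ne_zero (f := f) (by rintro rfl; simp at hfy)
        have hvf : v ∈ LinearMap.ker f := hf (mem_span_singleton_self v)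
        obtain ⟨m, rfl⟩ : ∃ m, n = m + 1 := ⟨n - 1, by omega⟩
        let v' : LinearMap.ker f := ⟨v, hvf⟩
        have hv' : v' ≠ 0 := fun h => hv0 (congrArg Subtype.val h)
        have hq := finrank_quot hv'
        obtain ⟨F, hF⟩ := exists_isFlag m (LinearMap.ker f ⧸ span ℂ {v'}) (by omega)
        have hF2 := upFlag_isFlag hv' hF
        have hF3 := hypFlag_isFlag hV hF2
        refine ⟨_, hF3, ?_, ?_, v, ?_, ?_⟩
        · intro k hk x hx
          obtain rfl : k = 0 := by omega
          simp only [hypFlag, upFlag, Nat.zero_le, if_true, Submodule.map_bot, mem_bot] at hx ⊢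
          simp [hx]
        · intro k hk x hx
          rw [hF3.top k hk]; trivial
        · unfold hypFlag
          rw [if_pos (by omega)]
          refine ⟨v', ?_, rfl⟩
          change (span ℂ {v'}).mkQ v' ∈ F 0
          have : (span ℂ {v'}).mkQ v' = 0 := by simp [mem_span_singleton_self]
          rw [this]; exact zero_mem _
        · unfold hypFlag
          rw [if_pos (by omega)]
          rintro ⟨⟨y, hy⟩, -, h⟩
          apply hfy
          rw [← h]
          exact hy
      · obtain ⟨H, hH, hTH, hns⟩ := exists_hyper (by omega) T hT
        obtain ⟨F, hF, h1, h2, x, hx, hxT⟩ := ih H (by omega) (T.restrict hTH) (by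
          intro c
          obtain ⟨x, hx, hne⟩ := hns c
          refine ⟨⟨x, hx⟩, fun h => hne ?_⟩
          exact congrArg Subtype.val h) i j hij (by omega)
        refine ⟨_, hypFlag_isFlag hV hF, ?_, ?_, x, ?_, ?_⟩
        · intro k hk
          unfold hypFlag
          rw [if_pos (by omega)]
          rintro _ ⟨y, hy, rfl⟩
          exact ⟨_, h1 k hk y hy, rfl⟩
        · intro k hk
          unfold hypFlag
          split_ifs
          · rintro _ ⟨y, hy, rfl⟩
            exact ⟨_, h2 k hk y hy, rfl⟩
          · intros; trivial
        · unfold hypFlag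
          rw [if_pos (by omega)]
          exact ⟨x, hx, rfl⟩
        · unfold hypFlag
          rw [if_pos (by omega)]
          rintro ⟨y, hy, h⟩
          apply hxT
          have : T.restrict hTH x = y := Subtype.ext h.symm
          rw [this]; exact hy
    · obtain ⟨i, rfl⟩ : ∃ m, i = m + 1 := ⟨i - 1, by omega⟩
      obtain ⟨j, rfl⟩ : ∃ m, j = m + 2 := ⟨j - 2, by omega⟩
      obtain ⟨w, hw0, ⟨μ, hμ⟩, hns⟩ := exists_line (by omega) T hT
      have hle : span ℂ {w} ≤ (span ℂ {w}).comap T := by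
        rw [span_singleton_le_iff_mem, mem_comap, hμ]
        exact smul_mem _ _ (mem_span_singleton_self w)
      have hq := finrank_quot hw0
      obtain ⟨F, hF, h1, h2, x, hx, hxT⟩ := ih (V ⧸ span ℂ {w}) (by omega)
        ((span ℂ {w}).mapQ _ T hle) (by
          intro c
          obtain ⟨x, hx⟩ := hns c
          refine ⟨(span ℂ {w}).mkQ x, fun h => hx ?_⟩
          rw [← Submodule.Quotient.mk_eq_zero]
          exact h) i (j + 1) (by omega) (by omega)
      refine ⟨_, upFlag_isFlag hw0 hF, ?_, ?_, ?_⟩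
      · rintro (_ | k) hk y hy
        · simp only [upFlag, mem_bot] at hy ⊢
          simp [hy]
        · exact h1 k (by omega) _ hy
      · rintro (_ | k) hk y hy
        · omega
        · exact h2 k (by omega) _ hy
      · obtain ⟨x, rfl⟩ := mkQ_surjective _ x
        exact ⟨x, hx, hxT⟩

theorem exists_flag_detecting_hess_fun {n : ℕ} (hn : 2 ≤ n)
    (X : Matrix (Fin n) (Fin n) ℂ)
    (hX : ∀ a : ℂ, X ≠ a • (1 : Matrix (Fin n) (Fin n) ℂ))
    (i j : ℕ) (hi : 1 ≤ i) (hij : i < j) (hj : j ≤ n) :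
    ∃ F : CompleteFlag n, ∀ h : ℕ → ℕ, IsStrictHessFun n h →
      (F ∈ Hess n X h ↔ j ≤ h i) := by
  obtain ⟨F, hF, h1, h2, x, hx, hxT⟩ := main_aux n (Fin n → ℂ) (by simp) X.mulVecLin (by
    intro c
    by_contra! hc
    apply hX c
    apply Matrix.toLin'.injective
    refine LinearMap.ext fun x => ?_
    have := sub_eq_zero.1 (hc x)
    simpa using this) (i - 1) j (by omega) hj
  rw [Nat.sub_add_cancel hi] at hx
  refine ⟨⟨F, hF.mono, hF.dim, hF.top⟩, ?_⟩
  intro h hh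
  constructor
  · intro hm
    by_contra! hlt
    exact hxT (hF.mono (show h i ≤ j - 1 by omega) (hm i hi (by omega) ⟨x, hx, rfl⟩))
  · intro hji k hk hkn
    rintro _ ⟨y, hy, rfl⟩
    change y ∈ F k at hy
    change X.mulVecLin y ∈ F (h k)
    have hkk := hh.2 k hk hkn
    by_cases hki : k < i
    · exact hF.mono hkk (h1 k (by omega) y hy)
    by_cases hkj : k < j
    · have := hh.1.1 i k hi (by omega) hkn
      exact hF.mono (hji.trans this) (h2 j le_rfl y (hF.mono hkj.le hy))
    · exact hF.mono hkk (h2 k (by omega) y hy)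
end

section
/- Let X be an n×n complex matrix, let 1 ≤ i ≤ j ≤ n, and let F be a complete flag in ℂⁿ satisfying: (1) X·F_k ⊆ F_k whenever k < i or k > j; (2) X·F_k ⊆ F_j whenever i ≤ k ≤ j; and (3) X·F_i is not contained in F_{j−1}. Then for every strict Hessenberg function h, the flag F lies in Hess(X,h) if and only if h(i) ≥ j. -/
open Matrix

/-- If a complete flag `F` satisfies `X Fₖ ⊆ Fₖ` for `k < i` or `k > j`,
`X Fₖ ⊆ F_j` for `i ≤ k ≤ j`, and `X F_i ⊄ F_{j-1}`, then for every strict Hessenberg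
function `h`, `F ∈ Hess(X,h)` iff `h(i) ≥ j`. -/
theorem mem_hess_iff_of_flag_conditions {n : ℕ} (X : Matrix (Fin n) (Fin n) ℂ)
    (i j : ℕ) (hi : 1 ≤ i) (hij : i ≤ j) (hj : j ≤ n) (F : CompleteFlag n)
    (h1 : ∀ k, (k < i ∨ j < k) → (F.F k).map X.mulVecLin ≤ F.F k)
    (h2 : ∀ k, i ≤ k → k ≤ j → (F.F k).map X.mulVecLin ≤ F.F j)
    (h3 : ¬ (F.F i).map X.mulVecLin ≤ F.F (j - 1)) :
    ∀ h : ℕ → ℕ, IsStrictHessFun n h → (F ∈ Hess n X h ↔ j ≤ h i) := by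
  intro h hh
  constructor
  · intro hF
    by_contra hlt
    exact h3 ((hF i hi (hij.trans hj)).trans (F.mono (by omega)))
  · intro hle k hk1 hkn
    by_cases hc : k < i ∨ j < k
    · exact (h1 k hc).trans (F.mono (hh.2 k hk1 hkn))
    · have hik : i ≤ k := by omega
      exact (h2 k hik (by omega)).trans (F.mono (hle.trans (hh.1.1 i k hi hik hkn)))
end

section
/- Let h : {1,…,n} → {0,1,…,n} be a Hessenberg function and let H_h be the corresponding Hessenberg space of matrices. Define h'(j) = n − #{k ∈ {1,…,n} : h(k) ≤ n−j} for j ∈ {1,…,n}. Then h' is a Hessenberg function (i.e. nondecreasing with values in {0,1,…,n}) and the flipped space ᵀH_h = {w₀ Mᵀ w₀ : M ∈ H_h} equals the Hessenberg space H_{h'}. -/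
open Matrix

theorem card_key {n : ℕ} (h : ℕ → ℕ) (hh : IsHessFun n h) (t m : ℕ) (h1 : 1 ≤ m) (hm : m ≤ n) :
    m ≤ ((Finset.Icc 1 n).filter (fun k => h k ≤ t)).card ↔ h m ≤ t := by
  constructor
  · intro hc
    by_contra hlt
    have hsub : (Finset.Icc 1 n).filter (fun k => h k ≤ t) ⊆ Finset.Icc 1 (m - 1) := by
      intro k hk
      simp only [Finset.mem_filter, Finset.mem_Icc] at hk ⊢
      refine ⟨hk.1.1, ?_⟩
      by_contra hk2
      have := hh.1 m k h1 (by omega) hk.1.2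
      omega
    have := Finset.card_le_card hsub
    simp only [Nat.card_Icc] at this
    omega
  · intro hle
    have hsub : Finset.Icc 1 m ⊆ (Finset.Icc 1 n).filter (fun k => h k ≤ t) := by
      intro k hk
      simp only [Finset.mem_filter, Finset.mem_Icc] at hk ⊢
      have := hh.1 k m hk.1 hk.2 hm
      omega
    have := Finset.card_le_card hsub
    simp only [Nat.card_Icc] at this
    omega

theorem w0_apply {n : ℕ} (i j : Fin n) : w0 n i j = if j = Fin.rev i then 1 else 0 := by
  simp only [w0, Matrix.of_apply, Fin.ext_iff, Fin.val_rev]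
  congr 1
  apply propext
  omega

theorem w0_apply2 {n : ℕ} (i j : Fin n) : w0 n i j = if i = Fin.rev j then 1 else 0 := by
  simp only [w0, Matrix.of_apply, Fin.ext_iff, Fin.val_rev]
  congr 1
  apply propext
  omega

theorem flip_apply {n : ℕ} (M : Matrix (Fin n) (Fin n) ℂ) (i j : Fin n) :
    (w0 n * Mᵀ * w0 n) i j = M (Fin.rev j) (Fin.rev i) := by
  have h1 : ∀ k, (w0 n * Mᵀ) i k = M k (Fin.rev i) := by
    intro k
    simp [Matrix.mul_apply, w0_apply]
  rw [Matrix.mul_apply]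
  simp [h1, w0_apply2]

/-- The antidiagonal flip of the Hessenberg space `H_h` is the Hessenberg space
`H_{h'}` where `h'(j) = n − #{k ∈ [1,n] : h(k) ≤ n − j}`, and `h'` is a Hessenberg function. -/
theorem flip_hessSpace_eq_hessSpace {n : ℕ} (h : ℕ → ℕ) (hh : IsHessFun n h)
    (h' : ℕ → ℕ)
    (hh' : ∀ j, h' j = n - ((Finset.Icc 1 n).filter (fun k => h k ≤ n - j)).card) :
    IsHessFun n h' ∧ flipSet n (HessSpace n h) = HessSpace n h' := by
  have key : ∀ i j : Fin n, h' (j.1 + 1) < i.1 + 1 ↔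
      h ((Fin.rev i).1 + 1) < (Fin.rev j).1 + 1 := by
    intro i j
    have hi := i.2
    have hj := j.2
    have := card_key h hh (n - (j.1 + 1)) (n - i.1) (by omega) (by omega)
    have e : (Fin.rev i).1 + 1 = n - i.1 := by rw [Fin.val_rev]; omega
    rw [e, Fin.val_rev, hh', Nat.lt_succ_iff, Nat.lt_succ_iff, ← this]
    omega
  refine ⟨⟨?_, ?_⟩, ?_⟩
  · intro i j _ hij _
    rw [hh', hh']
    apply Nat.sub_le_sub_left
    apply Finset.card_le_card
    intro k hk
    simp only [Finset.mem_filter] at hk ⊢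
    exact ⟨hk.1, by omega⟩
  · intro i _ _
    rw [hh']
    omega
  · ext N
    constructor
    · rintro ⟨M, hM, rfl⟩ i j hij
      show (w0 n * Mᵀ * w0 n) i j = 0
      rw [flip_apply]
      exact hM _ _ ((key i j).1 hij)
    · intro hN
      refine ⟨w0 n * Nᵀ * w0 n, ?_, ?_⟩
      · intro i j hij
        rw [flip_apply]
        apply hN
        rw [key]
        simpa using hij
      · ext i j
        show (w0 n * (w0 n * Nᵀ * w0 n)ᵀ * w0 n) i j = N i j
        rw [flip_apply, flip_apply, Fin.rev_rev, Fin.rev_rev]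
end

section
/- Let X be an n×n complex matrix and h a Hessenberg function with Hessenberg space H_h. Then the sets Hess_G(X,H_h) and Hess_G(X, ᵀH_h), viewed as topological subspaces of GL_n(ℂ), are homeomorphic. -/
open Matrix

open Polynomial in
lemma hessAux_functional (f : ℂ[X]) (hf : f ≠ 0) :
    ∃ ψ : (ℂ[X] ⧸ (Submodule.span ℂ[X] {f} : Ideal ℂ[X])) →ₗ[ℂ] ℂ,
      ∀ a, (∀ b, ψ (b * a) = 0) → a = 0 := by
  obtain ⟨g, hg, hfg⟩ : ∃ g : ℂ[X], g.Monic ∧ Associated g f :=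
    ⟨f * C f.leadingCoeff⁻¹, monic_mul_leadingCoeff_inv hf, by
      apply Associated.symm
      refine associated_mul_unit_right f _ ?_
      rw [isUnit_C]
      simpa using hf⟩
  have hmem : ∀ p : ℂ[X], p ∈ (Submodule.span ℂ[X] {f} : Ideal ℂ[X]) ↔ g ∣ p := by
    intro p
    rw [hfg.dvd_iff_dvd_left]
    exact Ideal.mem_span_singleton
  let φ : ℂ[X] →ₗ[ℂ] ℂ := (lcoeff ℂ (g.natDegree - 1)).comp (modByMonicHom g)
  have hφ : ∀ p, φ p = (p %ₘ g).coeff (g.natDegree - 1) := fun p => rfl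
  let I : Submodule ℂ ℂ[X] := (Submodule.span ℂ[X] {f}).restrictScalars ℂ
  have hI : I ≤ LinearMap.ker φ := by
    intro p hp
    have : g ∣ p := (hmem p).1 hp
    rw [LinearMap.mem_ker, hφ, (modByMonic_eq_zero_iff_dvd hg).2 this]
    simp
  let ψ : (ℂ[X] ⧸ (Submodule.span ℂ[X] {f} : Ideal ℂ[X])) →ₗ[ℂ] ℂ :=
    { toFun := I.liftQ φ hI
      map_add' := fun x y => (I.liftQ φ hI).map_add x y
      map_smul' := fun c x => (I.liftQ φ hI).map_smul c x }
  have hψ : ∀ p, ψ (Ideal.Quotient.mk _ p) = φ p := fun p => rfl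
  refine ⟨ψ, ?_⟩
  intro a
  obtain ⟨p, rfl⟩ := Ideal.Quotient.mk_surjective a
  intro h
  rw [Ideal.Quotient.eq_zero_iff_mem, hmem, ← modByMonic_eq_zero_iff_dvd hg]
  by_contra hr
  have hg1 : g ≠ 1 := by
    rintro rfl
    simp at hr
  have hlt : (p %ₘ g).natDegree < g.natDegree := natDegree_modByMonic_lt p hg hg1
  have h1 := h (Ideal.Quotient.mk _ (X ^ (g.natDegree - 1 - (p %ₘ g).natDegree)))
  rw [← map_mul, hψ, hφ] at h1
  have h2 : (X ^ (g.natDegree - 1 - (p %ₘ g).natDegree) * p) %ₘ g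
      = X ^ (g.natDegree - 1 - (p %ₘ g).natDegree) * (p %ₘ g) := by
    have : (X ^ (g.natDegree - 1 - (p %ₘ g).natDegree) * (p %ₘ g)) %ₘ g
        = X ^ (g.natDegree - 1 - (p %ₘ g).natDegree) * (p %ₘ g) := by
      rw [modByMonic_eq_self_iff hg]
      apply degree_lt_degree
      rw [natDegree_X_pow_mul _ hr]
      omega
    rw [← this, eq_comm, ← sub_eq_zero, ← sub_modByMonic, modByMonic_eq_zero_iff_dvd hg, ← mul_sub]
    apply Dvd.dvd.mul_left
    have := modByMonic_add_div p g
    exact ⟨-(p /ₘ g), by linear_combination this⟩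
  rw [h2, coeff_X_pow_mul'] at h1
  rw [if_pos (by omega)] at h1
  have : g.natDegree - 1 - (g.natDegree - 1 - (p %ₘ g).natDegree) = (p %ₘ g).natDegree := by omega
  rw [this] at h1
  exact hr (leadingCoeff_eq_zero.1 h1)

open Polynomial in
lemma hessAux_form {n : ℕ} (T : (Fin n → ℂ) →ₗ[ℂ] (Fin n → ℂ)) :
    ∃ B : (Fin n → ℂ) →ₗ[ℂ] (Fin n → ℂ) →ₗ[ℂ] ℂ, B.SeparatingRight ∧
      ∀ u v, B (T u) v = B u (T v) := by
  classical
  obtain ⟨ι, _, p, hp, e, ⟨E⟩⟩ := Module.equiv_directSum_of_isTorsion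
    (R := ℂ[X]) (M := Module.AEval' T) (Module.AEval.isTorsion_of_finiteDimensional ℂ (Fin n → ℂ) T)
  choose ψ hψ using fun i => hessAux_functional (p i ^ e i) (pow_ne_zero _ (hp i).ne_zero)
  let π : ∀ i, Module.AEval' T →ₗ[ℂ[X]] ℂ[X] ⧸ (Submodule.span ℂ[X] {p i ^ e i} : Ideal ℂ[X]) :=
    fun i => (DirectSum.component ℂ[X] ι _ i).comp E.toLinearMap
  let ρ : ∀ i, (Fin n → ℂ) →ₗ[ℂ] ℂ[X] ⧸ (Submodule.span ℂ[X] {p i ^ e i} : Ideal ℂ[X]) :=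
    fun i => ((π i).restrictScalars ℂ).comp (Module.AEval'.of T).toLinearMap
  have hρ : ∀ i u, ρ i u = π i (Module.AEval'.of T u) := fun i u => rfl
  have hT : ∀ i u, ρ i (T u) = Ideal.Quotient.mk _ X * ρ i u := by
    intro i u
    rw [hρ, ← Module.AEval'.X_smul_of, map_smul, ← hρ]
    rfl
  let B : (Fin n → ℂ) →ₗ[ℂ] (Fin n → ℂ) →ₗ[ℂ] ℂ :=
    ∑ i, (((LinearMap.mul ℂ _).compr₂ (ψ i)).compl₁₂ (ρ i) (ρ i))
  have hB : ∀ u v, B u v = ∑ i, ψ i (ρ i u * ρ i v) := by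
    intro u v
    simp [B, LinearMap.sum_apply]
  refine ⟨B, ?_, ?_⟩
  · intro v hv
    have h0 : ∀ i, ρ i v = 0 := by
      intro i
      apply hψ i
      intro b
      obtain ⟨m, hm⟩ := E.surjective (DirectSum.of _ i b)
      have h1 := hv ((Module.AEval'.of T).symm m)
      have h2 : ∀ j, ρ j ((Module.AEval'.of T).symm m) = (DirectSum.of
          (fun i => ℂ[X] ⧸ (Submodule.span ℂ[X] {p i ^ e i} : Ideal ℂ[X])) i b) j := by
        intro j
        rw [← hm, hρ, LinearEquiv.apply_symm_apply]
        rfl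
      rw [hB, Finset.sum_eq_single i] at h1
      · rw [h2, DirectSum.of_eq_same] at h1
        exact h1
      · intro j _ hj
        rw [h2, DirectSum.of_eq_of_ne _ _ _ hj, zero_mul, map_zero]
      · simp
    apply (Module.AEval'.of T).injective
    apply E.injective
    rw [map_zero, map_zero]
    ext i
    exact h0 i
  · intro u v
    rw [hB, hB]
    refine Finset.sum_congr rfl fun i _ => ?_
    rw [hT, hT]
    congr 1
    ring

lemma hessAux_similar {n : ℕ} (X : Matrix (Fin n) (Fin n) ℂ) :
    ∃ S : GL (Fin n) ℂ, Xᵀ * (S : Matrix (Fin n) (Fin n) ℂ) = S * X := by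
  obtain ⟨B, hB, hX⟩ := hessAux_form X.mulVecLin
  let S := LinearMap.toMatrix₂' ℂ B
  have hdet : S.det ≠ 0 := by
    rw [← LinearMap.separatingRight_toLinearMap₂'_iff_det_ne_zero]
    simpa [S] using hB
  refine ⟨Matrix.GeneralLinearGroup.mkOfDetNeZero S hdet, ?_⟩
  change Xᵀ * S = S * X
  have h1 := LinearMap.toMatrix₂'_comp (R := ℂ) B X.mulVecLin
  have h2 := LinearMap.toMatrix₂'_compl₂ (R := ℂ) B X.mulVecLin
  have h3 : LinearMap.toMatrix' X.mulVecLin = X := LinearMap.toMatrix'_toLin' X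
  rw [h3] at h1 h2
  rw [← h1, ← h2]
  congr 1
  refine LinearMap.ext fun u => LinearMap.ext fun v => ?_
  exact hX u v

lemma w0_mul_w0 (n : ℕ) : w0 n * w0 n = 1 := by
  ext i j
  rw [Matrix.mul_apply, Finset.sum_eq_single i.rev]
  · simp only [w0, Matrix.of_apply, Fin.val_rev, Matrix.one_apply, Fin.ext_iff]
    have := i.2
    have := j.2
    split_ifs <;> first | omega | simp
  · intro k _ hk
    have : ¬ (i.1 + k.1 + 1 = n) := by
      intro h
      apply hk
      ext
      rw [Fin.val_rev]
      omega
    simp [w0, this]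
  · simp

lemma w0_transpose (n : ℕ) : (w0 n)ᵀ = w0 n := by
  ext i j
  simp [w0, add_comm i.1 j.1]

def w0GL (n : ℕ) : GL (Fin n) ℂ := ⟨w0 n, w0 n, w0_mul_w0 n, w0_mul_w0 n⟩

/-- inverse transpose -/
def invTr {n : ℕ} (g : GL (Fin n) ℂ) : GL (Fin n) ℂ :=
  ⟨(↑g⁻¹ : Matrix (Fin n) (Fin n) ℂ)ᵀ, (g : Matrix (Fin n) (Fin n) ℂ)ᵀ,
    by rw [← Matrix.transpose_mul, Units.mul_inv, Matrix.transpose_one],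
    by rw [← Matrix.transpose_mul, Units.inv_mul, Matrix.transpose_one]⟩

lemma invTr_invTr {n : ℕ} (g : GL (Fin n) ℂ) : invTr (invTr g) = g := by
  apply Units.ext
  rfl

lemma continuous_invTr {n : ℕ} : Continuous (invTr (n := n)) := by
  rw [Units.continuous_iff]
  constructor
  · exact (Units.continuous_val.comp continuous_inv).matrix_transpose
  · exact Units.continuous_val.matrix_transpose

def invTrHomeo (n : ℕ) : GL (Fin n) ℂ ≃ₜ GL (Fin n) ℂ where
  toFun := invTr
  invFun := invTr
  left_inv := invTr_invTr
  right_inv := invTr_invTr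
  continuous_toFun := continuous_invTr
  continuous_invFun := continuous_invTr

lemma mem_flipSet_iff {n : ℕ} (H : Set (Matrix (Fin n) (Fin n) ℂ)) (M : Matrix (Fin n) (Fin n) ℂ) :
    w0 n * Mᵀ * w0 n ∈ flipSet n H ↔ M ∈ H := by
  constructor
  · rintro ⟨N, hN, h⟩
    have key : ∀ A : Matrix (Fin n) (Fin n) ℂ, w0 n * (w0 n * A * w0 n) * w0 n = A := by
      intro A
      calc _ = (w0 n * w0 n) * A * (w0 n * w0 n) := by simp only [mul_assoc]
        _ = A := by simp [w0_mul_w0]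
    have h' : w0 n * (w0 n * Nᵀ * w0 n) * w0 n = w0 n * (w0 n * Mᵀ * w0 n) * w0 n := by
      rw [show w0 n * Nᵀ * w0 n = w0 n * Mᵀ * w0 n from h]
    rw [key, key] at h'
    rwa [← Matrix.transpose_injective h']
  · intro h
    exact ⟨M, h, rfl⟩

/-- `Hess_G(X, H_h)` and `Hess_G(X, ᵀH_h)` are homeomorphic as topological
subspaces of `GL_n(ℂ)`. -/
theorem hessG_homeomorph_hessG_flip {n : ℕ} (X : Matrix (Fin n) (Fin n) ℂ)
    (h : ℕ → ℕ) (hh : IsHessFun n h) :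
    Nonempty ((HessG n X (HessSpace n h)) ≃ₜ (HessG n X (flipSet n (HessSpace n h)))) := by
  obtain ⟨S, hS⟩ := hessAux_similar X
  let Φ : GL (Fin n) ℂ ≃ₜ GL (Fin n) ℂ :=
    (invTrHomeo n).trans ((Homeomorph.mulLeft S⁻¹).trans (Homeomorph.mulRight (w0GL n)))
  refine ⟨Φ.subtype ?_⟩
  intro g
  have hΦ : Φ g = S⁻¹ * invTr g * w0GL n := rfl
  have hXt : (S : Matrix (Fin n) (Fin n) ℂ) * X * (↑S⁻¹ : Matrix (Fin n) (Fin n) ℂ) = Xᵀ := by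
    rw [← hS, mul_assoc, Units.mul_inv, mul_one]
  have e1 : (↑(Φ g) : Matrix (Fin n) (Fin n) ℂ)
      = (↑S⁻¹ : Matrix (Fin n) (Fin n) ℂ) * (↑g⁻¹ : Matrix (Fin n) (Fin n) ℂ)ᵀ * w0 n := rfl
  have e2 : (↑(Φ g)⁻¹ : Matrix (Fin n) (Fin n) ℂ)
      = w0 n * ((g : Matrix (Fin n) (Fin n) ℂ)ᵀ * (S : Matrix (Fin n) (Fin n) ℂ)) := by
    rw [hΦ, _root_.mul_inv_rev, _root_.mul_inv_rev, inv_inv]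
    rfl
  change (↑g⁻¹ : Matrix (Fin n) (Fin n) ℂ) * X * (↑g : Matrix (Fin n) (Fin n) ℂ) ∈ HessSpace n h ↔
    (↑(Φ g)⁻¹ : Matrix (Fin n) (Fin n) ℂ) * X *
    (↑(Φ g) : Matrix (Fin n) (Fin n) ℂ) ∈ flipSet n (HessSpace n h)
  rw [← mem_flipSet_iff]
  rw [e1, e2, Matrix.transpose_mul, Matrix.transpose_mul, ← hXt]
  simp only [mul_assoc]
end

section
/- Let 0 < j < n and let h be a strict Hessenberg function on {1,…,n} with h(j) = j. Define strict Hessenberg functions h₁ on {1,…,j} by h₁(i) = h(i), and h₂ on {1,…,n−j} by h₂(i) = h(i+j) − j. Let N, N₁, N₂ be the regular nilpotent matrices of sizes n, j, and n−j respectively. Then there is a bijection between Hess(N,h) and the product Hess(N₁,h₁) × Hess(N₂,h₂). -/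
open Matrix

theorem CompleteFlag.ext_F {n : ℕ} {A B : CompleteFlag n} (hF : ∀ i, A.F i = B.F i) : A = B := by
  cases A; cases B
  simp only [CompleteFlag.mk.injEq]
  exact funext hF

noncomputable def hIota (j m : ℕ) : (Fin j → ℂ) →ₗ[ℂ] (Fin (j + m) → ℂ) where
  toFun v := Fin.append v 0
  map_add' v w := by
    ext i
    refine Fin.addCases (fun i => ?_) (fun i => ?_) i <;> simp
  map_smul' c v := by
    ext i
    refine Fin.addCases (fun i => ?_) (fun i => ?_) i <;> simp

noncomputable def hPi (j m : ℕ) : (Fin (j + m) → ℂ) →ₗ[ℂ] (Fin m → ℂ) :=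
  LinearMap.funLeft ℂ ℂ (Fin.natAdd j)

theorem hPi_apply (j m : ℕ) (v) (i : Fin m) : hPi j m v i = v (Fin.natAdd j i) := rfl

theorem hIota_inj (j m : ℕ) : Function.Injective (hIota j m) := by
  intro v w hvw
  ext i
  have := congrFun hvw (Fin.castAdd m i)
  simpa [hIota] using this

theorem hPi_surj (j m : ℕ) : Function.Surjective (hPi j m) := by
  intro w
  refine ⟨Fin.append 0 w, ?_⟩
  ext i
  simp [hPi_apply]

theorem hPi_hIota (j m : ℕ) (v) : hPi j m (hIota j m v) = 0 := by
  ext i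
  simp [hPi_apply, hIota]

theorem hker (j m : ℕ) : LinearMap.ker (hPi j m) = LinearMap.range (hIota j m) := by
  apply le_antisymm
  · intro v hv
    refine ⟨fun i => v (Fin.castAdd m i), ?_⟩
    ext i
    refine Fin.addCases (fun i => ?_) (fun i => ?_) i
    · simp [hIota]
    · have := congrFun (LinearMap.mem_ker.1 hv) i
      rw [hPi_apply] at this
      simp [hIota, this]
  · rintro _ ⟨v, rfl⟩
    exact hPi_hIota j m v

theorem finrank_range_hIota (j m : ℕ) :
    Module.finrank ℂ (LinearMap.range (hIota j m)) = j := by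
  rw [LinearMap.finrank_range_of_inj (hIota_inj j m)]; simp

theorem finrank_map_hIota (j m : ℕ) (A : Submodule ℂ (Fin j → ℂ)) :
    Module.finrank ℂ (A.map (hIota j m)) = Module.finrank ℂ A :=
  (Submodule.equivMapOfInjective (hIota j m) (hIota_inj j m) A).finrank_eq.symm

theorem regNil_apply (n : ℕ) (v : Fin n → ℂ) (i : Fin n) :
    (regNil n).mulVecLin v i = if hi : i.1 + 1 < n then v ⟨i.1 + 1, hi⟩ else 0 := by
  simp only [Matrix.mulVecLin_apply, Matrix.mulVec, dotProduct, regNil, Matrix.of_apply]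
  split_ifs with hi
  · rw [Finset.sum_eq_single ⟨i.1 + 1, hi⟩]
    · simp
    · intro b _ hb
      rw [if_neg, zero_mul]
      intro h; apply hb; ext; simp [h]
    · simp
  · apply Finset.sum_eq_zero
    intro b _
    rw [if_neg, zero_mul]
    have := b.2
    omega

theorem regNil_pow_apply (n k : ℕ) (v : Fin n → ℂ) (i : Fin n) :
    (((regNil n).mulVecLin) ^ k) v i = if hi : i.1 + k < n then v ⟨i.1 + k, hi⟩ else 0 := by
  induction k generalizing v i with
  | zero => simp
  | succ k ih =>
    rw [pow_succ', Module.End.mul_apply, regNil_apply]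
    split_ifs with h1 h2 h2
    · rw [ih, dif_pos (by simp only; omega)]
      congr 2; simp only; omega
    · rw [ih, dif_neg (by simp only; omega)]
    · omega
    · rfl

theorem regNil_iota (j m : ℕ) (v) :
    (regNil (j + m)).mulVecLin (hIota j m v) = hIota j m ((regNil j).mulVecLin v) := by
  ext i
  rw [regNil_apply]
  refine Fin.addCases (fun i => ?_) (fun i => ?_) i
  · have hr : hIota j m ((regNil j).mulVecLin v) (Fin.castAdd m i) = (regNil j).mulVecLin v i := by
      simp only [hIota, LinearMap.coe_mk, AddHom.coe_mk, Fin.append_left]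
    rw [hr, regNil_apply]
    have hi := i.2
    simp only [Fin.val_castAdd]
    split_ifs with h1 h2 h2
    · exact Fin.append_left v 0 ⟨i.1 + 1, h2⟩
    · have : (⟨i.1 + 1, h1⟩ : Fin (j + m)) = Fin.natAdd j ⟨0, by omega⟩ := by
        ext; simp; omega
      rw [this]
      exact Fin.append_right v 0 _
    · omega
    · rfl
  · have hr : hIota j m ((regNil j).mulVecLin v) (Fin.natAdd j i) = 0 := by
      simp [hIota]
    rw [hr]
    split_ifs with h1
    · have : (⟨(Fin.natAdd j i).1 + 1, h1⟩ : Fin (j + m)) =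
          Fin.natAdd j ⟨i.1 + 1, by simp at h1; omega⟩ := by
        ext; simp; omega
      rw [this]
      exact Fin.append_right v 0 _
    · rfl

theorem regNil_pi (j m : ℕ) (v) :
    hPi j m ((regNil (j + m)).mulVecLin v) = (regNil m).mulVecLin (hPi j m v) := by
  ext i
  rw [hPi_apply, regNil_apply, regNil_apply]
  simp only [Fin.val_natAdd]
  split_ifs with h1 h2 h2
  · rw [hPi_apply]; congr 1
  · omega
  · omega
  · rfl

theorem finrank_comap_hPi (j m : ℕ) (B : Submodule ℂ (Fin m → ℂ)) :
    Module.finrank ℂ (B.comap (hPi j m)) = j + Module.finrank ℂ B := by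
  have h := LinearMap.finrank_range_add_finrank_ker ((hPi j m).domRestrict (B.comap (hPi j m)))
  have h1 : LinearMap.range ((hPi j m).domRestrict (B.comap (hPi j m))) = B := by
    rw [LinearMap.range_domRestrict, Submodule.map_comap_eq_of_surjective (hPi_surj j m)]
  have h2 : Module.finrank ℂ (LinearMap.ker ((hPi j m).domRestrict (B.comap (hPi j m)))) = j := by
    rw [LinearMap.ker_domRestrict]
    rw [(Submodule.comapSubtypeEquivOfLe (LinearMap.ker_le_comap (hPi j m))).finrank_eq, hker,
      finrank_range_hIota]
  rw [h1, h2] at h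
  omega

theorem invariant_eq (j m : ℕ) (W : Submodule ℂ (Fin (j + m) → ℂ))
    (hd : Module.finrank ℂ W = j) (hW : W.map (regNil (j + m)).mulVecLin ≤ W) :
    W = LinearMap.range (hIota j m) := by
  apply Submodule.eq_of_le_of_finrank_eq _ (by rw [hd, finrank_range_hIota])
  have hinv : ∀ x ∈ W, (regNil (j + m)).mulVecLin x ∈ W :=
    fun x hx => hW (Submodule.mem_map_of_mem hx)
  set f := (regNil (j + m)).mulVecLin.restrict hinv with hf
  have hpow : ∀ k (x : W), ((f ^ k) x : Fin (j + m) → ℂ) = ((regNil (j + m)).mulVecLin ^ k) x := by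
    intro k
    induction k with
    | zero => intro x; simp
    | succ k ih =>
      intro x
      rw [pow_succ, pow_succ, Module.End.mul_apply, Module.End.mul_apply, ih]
      rfl
  have hnil : IsNilpotent f := by
    refine ⟨j + m, ?_⟩
    ext x i
    rw [hpow, regNil_pow_apply, dif_neg (by omega)]
    rfl
  have hz : f ^ j = 0 := by
    have h1 := LinearMap.charpoly_eq_X_pow_iff f |>.2 (by
      obtain ⟨k, hk⟩ := hnil
      intro x; exact ⟨k, by rw [hk]; rfl⟩)
    have h2 := LinearMap.aeval_self_charpoly f
    rw [h1, hd] at h2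
    simpa using h2
  intro v hv
  rw [← hker]
  ext i
  have h3 := hpow j ⟨v, hv⟩
  rw [hz] at h3
  have h4 := congrFun h3 ⟨i.1, by omega⟩
  rw [regNil_pow_apply, dif_pos (by simp only; omega)] at h4
  rw [hPi_apply]
  simp only [LinearMap.zero_apply, ZeroMemClass.coe_zero, Pi.zero_apply] at h4
  rw [Pi.zero_apply, h4]
  congr 1
  ext
  simp; omega

theorem map_comap_hIota {j m : ℕ} (F : CompleteFlag (j + m))
    (hF : F.F j = LinearMap.range (hIota j m)) (i : ℕ) (hi : i ≤ j) :
    ((F.F i).comap (hIota j m)).map (hIota j m) = F.F i := by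
  rw [Submodule.map_comap_eq, ← hF]
  exact inf_eq_right.2 (F.mono hi)

noncomputable def flagFst {j m : ℕ} (F : CompleteFlag (j + m))
    (hF : F.F j = LinearMap.range (hIota j m)) : CompleteFlag j where
  F i := (F.F i).comap (hIota j m)
  mono a b hab := Submodule.comap_mono (F.mono hab)
  dim i hi := by
    rw [← finrank_map_hIota, map_comap_hIota F hF i hi, F.dim i (by omega)]
  top i hi := by
    rw [eq_top_iff]
    intro v _
    exact F.mono hi (hF ▸ ⟨v, rfl⟩)

theorem comap_map_hPi {j m : ℕ} (F : CompleteFlag (j + m))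
    (hF : F.F j = LinearMap.range (hIota j m)) (i : ℕ) (hi : j ≤ i) :
    ((F.F i).map (hPi j m)).comap (hPi j m) = F.F i := by
  rw [Submodule.comap_map_eq, hker, ← hF]
  exact sup_eq_left.2 (F.mono hi)

noncomputable def flagSnd {j m : ℕ} (F : CompleteFlag (j + m))
    (hF : F.F j = LinearMap.range (hIota j m)) : CompleteFlag m where
  F i := (F.F (i + j)).map (hPi j m)
  mono a b hab := Submodule.map_mono (F.mono (by omega))
  dim i hi := by
    have h1 := finrank_comap_hPi j m ((F.F (i + j)).map (hPi j m))
    rw [comap_map_hPi F hF _ (by omega), F.dim _ (by omega)] at h1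
    omega
  top i hi := by
    rw [F.top _ (by omega), Submodule.map_top, LinearMap.range_eq_top.2 (hPi_surj j m)]

noncomputable def flagGlue {j m : ℕ} (A : CompleteFlag j) (B : CompleteFlag m) :
    CompleteFlag (j + m) where
  F i := if i ≤ j then (A.F i).map (hIota j m) else (B.F (i - j)).comap (hPi j m)
  mono a b hab := by
    dsimp only
    split_ifs with h1 h2 h2
    · exact Submodule.map_mono (A.mono hab)
    · rintro _ ⟨v, _, rfl⟩
      rw [Submodule.mem_comap, hPi_hIota]
      exact zero_mem _
    · omega
    · exact Submodule.comap_mono (B.mono (by omega))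
  dim i hi := by
    by_cases h1 : i ≤ j
    · rw [if_pos h1, finrank_map_hIota, A.dim i h1]
    · rw [if_neg h1, finrank_comap_hPi, B.dim _ (by omega)]; omega
  top i hi := by
    split_ifs with h1
    · have : m = 0 := by omega
      subst this
      rw [A.top _ (by omega), Submodule.map_top, ← hker, eq_top_iff]
      intro v _
      exact Subsingleton.elim _ _
    · rw [B.top _ (by omega), Submodule.comap_top]

theorem hess_aux {n j m : ℕ} (hn : n = j + m) (hj0 : 0 < j)
    (h : ℕ → ℕ) (hh : IsStrictHessFun n h) (hhj : h j = j) :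
    Nonempty ((Hess n (regNil n) h) ≃
      (Hess j (regNil j) h) × (Hess m (regNil m) (fun i => h (i + j) - j))) := by
  subst hn
  obtain ⟨⟨hmono, hle⟩, hst⟩ := hh
  have key : ∀ F : Hess (j + m) (regNil (j + m)) h,
      F.1.F j = LinearMap.range (hIota j m) := fun F => by
    refine invariant_eq j m _ (F.1.dim j (by omega)) ?_
    have := F.2 j hj0 (by omega)
    rwa [hhj] at this
  refine ⟨⟨fun F => (⟨flagFst F.1 (key F), ?_⟩, ⟨flagSnd F.1 (key F), ?_⟩),
    fun P => ⟨flagGlue P.1.1 P.2.1, ?_⟩, ?_, ?_⟩⟩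
  · intro i h1 h2
    rintro _ ⟨v, hv, rfl⟩
    change hIota j m _ ∈ F.1.F (h i)
    rw [← regNil_iota]
    exact F.2 i h1 (by omega) (Submodule.mem_map_of_mem hv)
  · intro i h1 h2
    rintro _ ⟨_, ⟨v, hv, rfl⟩, rfl⟩
    rw [← regNil_pi]
    refine Submodule.mem_map_of_mem ?_
    have h3 := hst (i + j) (by omega) (by omega)
    rw [Nat.sub_add_cancel (by omega)]
    exact F.2 (i + j) (by omega) (by omega) (Submodule.mem_map_of_mem hv)
  · intro i h1 h2
    rintro _ ⟨v, hv, rfl⟩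
    have h3 := hst i h1 h2
    by_cases h4 : i ≤ j
    · have h5 := hmono i j h1 h4 (by omega)
      rw [hhj] at h5
      simp only [flagGlue, if_pos h4, if_pos h5] at hv ⊢
      obtain ⟨w, hw, rfl⟩ := hv
      rw [regNil_iota]
      exact Submodule.mem_map_of_mem (P.1.2 i h1 h4 (Submodule.mem_map_of_mem hw))
    · have h5 : ¬ h i ≤ j := by omega
      simp only [flagGlue, if_neg h4, if_neg h5] at hv ⊢
      rw [Submodule.mem_comap, regNil_pi]
      have h6 := P.2.2 (i - j) (by omega) (by omega) (Submodule.mem_map_of_mem hv)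
      simpa only [Nat.sub_add_cancel (by omega : j ≤ i)] using h6
  · intro F
    apply Subtype.ext
    apply CompleteFlag.ext_F
    intro i
    by_cases h4 : i ≤ j
    · simp only [flagGlue, if_pos h4, flagFst]
      exact map_comap_hIota F.1 (key F) i h4
    · simp only [flagGlue, if_neg h4, flagSnd]
      rw [Nat.sub_add_cancel (by omega)]
      exact comap_map_hPi F.1 (key F) i (by omega)
  · intro P
    apply Prod.ext
    · apply Subtype.ext
      apply CompleteFlag.ext_F
      intro i
      by_cases h4 : i ≤ j
      · simp only [flagGlue, if_pos h4, flagFst]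
        exact Submodule.comap_map_eq_of_injective (hIota_inj j m) _
      · rw [CompleteFlag.top _ i (by omega), CompleteFlag.top _ i (by omega)]
    · apply Subtype.ext
      apply CompleteFlag.ext_F
      intro i
      by_cases h4 : i = 0
      · subst h4
        rw [Submodule.finrank_eq_zero.1 (CompleteFlag.dim _ 0 (by omega)),
          Submodule.finrank_eq_zero.1 (CompleteFlag.dim _ 0 (by omega))]
      · simp only [flagGlue, if_neg (by omega : ¬ i + j ≤ j), flagSnd, Nat.add_sub_cancel]
        exact Submodule.map_comap_eq_of_surjective (hPi_surj j m) _

/-- If `h` is a strict Hessenberg function with `h(j) = j` for some `0 < j < n`,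
then `Hess(N,h)` is in bijection with `Hess(N₁,h₁) × Hess(N₂,h₂)` where `h₁(i) = h(i)`,
`h₂(i) = h(i+j) − j`, and `N, N₁, N₂` are the regular nilpotents of sizes `n, j, n−j`. -/
theorem hess_regNil_decomposes {n j : ℕ} (hj0 : 0 < j) (hjn : j < n)
    (h : ℕ → ℕ) (hh : IsStrictHessFun n h) (hhj : h j = j) :
    Nonempty ((Hess n (regNil n) h) ≃
      (Hess j (regNil j) h) × (Hess (n - j) (regNil (n - j)) (fun i => h (i + j) - j))) := by
  exact hess_aux (by omega) hj0 h hh hhj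
end

section
/- Let N be the regular nilpotent n×n matrix. For every pair of indices 1 ≤ i < j ≤ n there exists a complete flag F in ℂⁿ such that each subspace F_k is spanned by standard basis vectors (a coordinate flag), and for every strict Hessenberg function h, F ∈ Hess(N,h) if and only if h(i) ≥ j. -/
open Matrix

def pfun (i j m : ℕ) : ℕ := if m + 1 = i then j - 1 else if i ≤ m ∧ m < j then m - 1 else m

def cS (n i j k : ℕ) : Set (Fin n) := {m | pfun i j m.1 < k}

def cF (n i j k : ℕ) : Submodule ℂ (Fin n → ℂ) :=
  Submodule.span ℂ ((fun m : Fin n => Pi.single m (1 : ℂ)) '' cS n i j k)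

theorem mem_cF {n i j k : ℕ} (v : Fin n → ℂ) :
    v ∈ cF n i j k ↔ ∀ m : Fin n, v m ≠ 0 → pfun i j m.1 < k := by
  have h : (fun m : Fin n => (Pi.single m (1 : ℂ) : Fin n → ℂ)) = Pi.basisFun ℂ (Fin n) := by
    ext m; simp
  rw [cF, h, Module.Basis.mem_span_image]
  simp [Set.subset_def, cS]

theorem cF_dim {n i j k : ℕ} (hi : 1 ≤ i) (hij : i < j) (hj : j ≤ n) (hk : k ≤ n) :
    Module.finrank ℂ (cF n i j k) = k := by
  classical
  have hlt : ∀ m : Fin n, pfun i j m.1 < n := by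
    intro m; have := m.2; unfold pfun; split_ifs <;> omega
  let p : Fin n → Fin n := fun m => ⟨pfun i j m.1, hlt m⟩
  have hp : Function.Injective p := by
    intro a b hab
    have h := congrArg Fin.val hab
    simp only [p] at h
    unfold pfun at h
    apply Fin.ext
    split_ifs at h <;> omega
  let e : Fin n ≃ Fin n := Equiv.ofBijective p (Finite.injective_iff_bijective.1 hp)
  have h : (fun m : Fin n => (Pi.single m (1 : ℂ) : Fin n → ℂ)) = Pi.basisFun ℂ (Fin n) := by
    ext m; simp
  have hli : LinearIndependent ℂ (fun m : cS n i j k => Pi.basisFun ℂ (Fin n) m.1) :=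
    (Pi.basisFun ℂ (Fin n)).linearIndependent.comp _ Subtype.val_injective
  have h2 := finrank_span_eq_card hli
  rw [cF, h, Set.image_eq_range, h2]
  let e2 : cS n i j k ≃ {x : Fin n // x.1 < k} :=
    e.subtypeEquiv (fun a => Iff.rfl)
  let e3 : {x : Fin n // x.1 < k} ≃ Fin k :=
    { toFun := fun x => ⟨x.1.1, x.2⟩
      invFun := fun x => ⟨⟨x.1, by omega⟩, x.2⟩
      left_inv := fun x => rfl
      right_inv := fun x => rfl }
  rw [Fintype.card_congr (e2.trans e3), Fintype.card_fin]

def cFlag (n i j : ℕ) (hi : 1 ≤ i) (hij : i < j) (hj : j ≤ n) : CompleteFlag n where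
  F := cF n i j
  mono := by
    intro a b hab v hv
    rw [mem_cF] at *
    exact fun m hm => (hv m hm).trans_le hab
  dim := fun k hk => cF_dim hi hij hj hk
  top := by
    intro k hk
    rw [eq_top_iff]
    intro v _
    rw [mem_cF]
    intro m _
    have := m.2
    unfold pfun; split_ifs <;> omega

theorem regNil_mul {n : ℕ} (v : Fin n → ℂ) (m : Fin n) :
    (regNil n *ᵥ v) m = if h : m.1 + 1 < n then v ⟨m.1 + 1, h⟩ else 0 := by
  simp only [mulVec, dotProduct, regNil, of_apply, ite_mul, one_mul, zero_mul]
  split_ifs with h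
  · rw [Finset.sum_eq_single ⟨m.1 + 1, h⟩]
    · simp
    · intro b _ hb
      rw [if_neg]
      intro h'; apply hb; ext; simp [h']
    · simp
  · apply Finset.sum_eq_zero
    intro b _
    rw [if_neg]
    have := b.2
    omega

/-- For the regular nilpotent `N` and any `1 ≤ i < j ≤ n`, there is a complete
coordinate flag (each subspace spanned by standard basis vectors) lying in `Hess(N,h)`
exactly for those strict Hessenberg functions `h` with `h(i) ≥ j`. -/
theorem exists_coordinate_flag_detecting_hess_fun {n : ℕ}
    (i j : ℕ) (hi : 1 ≤ i) (hij : i < j) (hj : j ≤ n) :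
    ∃ F : CompleteFlag n,
      (∀ k : ℕ, ∃ S : Set (Fin n),
        F.F k = Submodule.span ℂ ((fun m : Fin n => Pi.single m (1 : ℂ)) '' S)) ∧
      ∀ h : ℕ → ℕ, IsStrictHessFun n h → (F ∈ Hess n (regNil n) h ↔ j ≤ h i) := by
  refine ⟨cFlag n i j hi hij hj, fun k => ⟨cS n i j k, rfl⟩, fun h hh => ⟨fun H => ?_, fun H => ?_⟩⟩
  · have H1 := H i hi (by omega)
    have hv : (Pi.single ⟨i, by omega⟩ 1 : Fin n → ℂ) ∈ cF n i j i := by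
      rw [mem_cF]
      intro m hm
      have : m = ⟨i, by omega⟩ := by
        by_contra hne
        exact hm (Pi.single_eq_of_ne hne _)
      subst this
      unfold pfun; split_ifs <;> grind
    have H2 := H1 (Submodule.mem_map_of_mem hv)
    change _ ∈ cF n i j (h i) at H2
    rw [mem_cF] at H2
    have H3 := H2 ⟨i - 1, by omega⟩ (by
      rw [mulVecLin_apply, regNil_mul]
      have : i - 1 + 1 = i := by omega
      have h4 : i < n := by omega
      simp [this, h4])
    simp only [pfun] at H3
    rw [if_pos (by omega)] at H3
    omega
  · intro k hk1 hkn
    rw [Submodule.map_le_iff_le_comap]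
    intro v hv
    change v ∈ cF n i j k at hv
    change _ ∈ cF n i j (h k)
    rw [mem_cF] at *
    intro m hm
    rw [mulVecLin_apply, regNil_mul] at hm
    split_ifs at hm with hlt
    · have h1 := hv _ hm
      have h2 := hh.2 k hk1 hkn
      by_cases hmi : m.1 + 1 = i
      · have h3 := hh.1.1 i k hi (by
          simp only [pfun] at h1; split_ifs at h1 <;> omega) hkn
        simp only [pfun, if_pos hmi]; omega
      · simp only [pfun] at h1 ⊢
        split_ifs at h1 ⊢ <;> omega
    · exact absurd rfl hm
end

section
/- Let X be a diagonal n×n complex matrix whose first two diagonal entries are distinct (X₁₁ ≠ X₂₂), and let 1 ≤ i < j ≤ n. Define vectors A₁,…,Aₙ in ℂⁿ by: A_k = e_{k+2} for k < i; A_i = e₁ + e₂; A_k = e_{k+1} for i < k < j; A_j = e₁; and A_k = e_k for k > j. Then F, defined by F_k = span{A₁,…,A_k}, is a complete flag in ℂⁿ, and for every strict Hessenberg function h, F ∈ Hess(X,h) if and only if h(i) ≥ j. -/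
open Matrix

/-- The `m`-th standard basis vector of `ℂⁿ` (1-indexed: valid for `1 ≤ m ≤ n`). -/
noncomputable def stdVec (n m : ℕ) : Fin n → ℂ :=
  if h : 1 ≤ m ∧ m ≤ n then Pi.single (⟨m - 1, by omega⟩ : Fin n) (1 : ℂ) else 0

theorem stdVec_zero_apply {n : ℕ} (m : ℕ) (a : Fin n) :
    stdVec n m a = if a.1 + 1 = m then 1 else 0 := by
  unfold stdVec
  split_ifs with h1 h2 h2
  · have : a = ⟨m - 1, by omega⟩ := Fin.ext (by simp; omega)
    rw [← this]
    simp
  · have : a ≠ ⟨m - 1, by omega⟩ := fun h => h2 (by rw [h]; simp; omega)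
    simp [this]
  · have := a.2
    omega
  · rfl

theorem diag_stdVec {n : ℕ} (d : Fin n → ℂ) (m : ℕ) :
    ∃ c : ℂ, (Matrix.diagonal d).mulVecLin (stdVec n m) = c • stdVec n m := by
  by_cases h : 1 ≤ m ∧ m ≤ n
  · refine ⟨d ⟨m - 1, by omega⟩, ?_⟩
    ext a
    simp only [Matrix.mulVecLin_apply, Matrix.mulVec_diagonal, Pi.smul_apply, smul_eq_mul,
      stdVec_zero_apply]
    split_ifs with h2
    · have : a = ⟨m - 1, by omega⟩ := Fin.ext (by simp; omega)
      rw [this]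
    · simp
  · refine ⟨0, ?_⟩
    have : stdVec n m = 0 := by simp [stdVec, h]
    simp [this]

/-- For a diagonal matrix `X` with `X₁₁ ≠ X₂₂` and `1 ≤ i < j ≤ n`, the flag
`F_k = span{A₁,…,A_k}` built from `A_k = e_{k+2}` (`k < i`), `A_i = e₁ + e₂`,
`A_k = e_{k+1}` (`i < k < j`), `A_j = e₁`, `A_k = e_k` (`k > j`) is a complete flag, and for
every strict Hessenberg function `h`, `F ∈ Hess(X,h)` iff `h(i) ≥ j`. -/
theorem diagonal_flag_detects_hess_fun {n : ℕ}
    (i j : ℕ) (hi : 1 ≤ i) (hij : i < j) (hj : j ≤ n)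
    (d : Fin n → ℂ)
    (hd : d (⟨0, by omega⟩ : Fin n) ≠ d (⟨1, by omega⟩ : Fin n))
    (A : ℕ → (Fin n → ℂ))
    (hA : ∀ k, A k =
      if k < i then stdVec n (k + 2)
      else if k = i then stdVec n 1 + stdVec n 2
      else if k < j then stdVec n (k + 1)
      else if k = j then stdVec n 1
      else stdVec n k) :
    ∃ F : CompleteFlag n,
      (∀ k, k ≤ n → F.F k = Submodule.span ℂ (A '' {m : ℕ | 1 ≤ m ∧ m ≤ k})) ∧
      ∀ h : ℕ → ℕ, IsStrictHessFun n h →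
        (F ∈ Hess n (Matrix.diagonal d) h ↔ j ≤ h i) := by
  have hAi : A i = stdVec n 1 + stdVec n 2 := by rw [hA]; simp
  have hAj : A j = stdVec n 1 := by
    rw [hA, if_neg (by omega), if_neg (by omega), if_neg (by omega), if_pos rfl]
  set G : ℕ → Submodule ℂ (Fin n → ℂ) :=
    fun k => Submodule.span ℂ (A '' {m : ℕ | 1 ≤ m ∧ m ≤ k}) with hG
  have hmono : Monotone G := by
    intro a b hab
    apply Submodule.span_mono
    apply Set.image_mono
    intro m hm
    exact ⟨hm.1, hm.2.trans hab⟩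
  have hmem : ∀ m k, 1 ≤ m → m ≤ k → A m ∈ G k := fun m k h1 h2 =>
    Submodule.subset_span ⟨m, ⟨h1, h2⟩, rfl⟩
  have hstd : ∀ m, 1 ≤ m → m ≤ n → stdVec n m ∈ G n := by
    intro m h1 h2
    by_cases e1 : m = 1
    · subst e1; rw [← hAj]; exact hmem j n (by omega) hj
    by_cases e2 : m = 2
    · subst e2
      have : stdVec n 2 = A i - A j := by rw [hAi, hAj]; simp
      rw [this]
      exact sub_mem (hmem i n hi (by omega)) (hmem j n (by omega) hj)
    by_cases e3 : m ≤ i + 1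
    · have : stdVec n m = A (m - 2) := by
        rw [hA, if_pos (by omega)]; congr 1; omega
      rw [this]; exact hmem _ _ (by omega) (by omega)
    by_cases e4 : m ≤ j
    · have : stdVec n m = A (m - 1) := by
        rw [hA, if_neg (by omega), if_neg (by omega), if_pos (by omega)]; congr 1; omega
      rw [this]; exact hmem _ _ (by omega) (by omega)
    · have : stdVec n m = A m := by
        rw [hA, if_neg (by omega), if_neg (by omega), if_neg (by omega), if_neg (by omega)]
      rw [this]; exact hmem _ _ (by omega) (by omega)
  have htopn : G n = ⊤ := by
    rw [eq_top_iff]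
    intro v _
    have : v = ∑ a : Fin n, v a • stdVec n (a.1 + 1) := by
      ext b
      simp [Finset.sum_apply, stdVec_zero_apply, Fin.val_inj]
    rw [this]
    exact sum_mem fun a _ => Submodule.smul_mem _ _ (hstd _ (by omega) (by have := a.2; omega))
  have hrange : ∀ k, Set.range (fun a : Fin k => A (a.1 + 1)) = A '' {m : ℕ | 1 ≤ m ∧ m ≤ k} := by
    intro k
    ext v
    constructor
    · rintro ⟨a, rfl⟩
      exact ⟨a.1 + 1, ⟨by omega, by have := a.2; omega⟩, rfl⟩
    · rintro ⟨m, ⟨h1, h2⟩, rfl⟩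
      refine ⟨⟨m - 1, by omega⟩, ?_⟩
      simp only
      congr 1; omega
  have hli : LinearIndependent ℂ (fun a : Fin n => A (a.1 + 1)) := by
    apply linearIndependent_of_top_le_span_of_card_eq_finrank
    · rw [hrange]; exact htopn.ge
    · simp
  have hdim : ∀ k, k ≤ n → Module.finrank ℂ (G k) = k := by
    intro k hk
    have h2 : LinearIndependent ℂ (fun a : Fin k => A (a.1 + 1)) :=
      hli.comp (Fin.castLE hk) (Fin.castLE_injective hk)
    have h3 := finrank_span_eq_card h2
    rw [hrange] at h3
    simpa using h3
  refine ⟨⟨G, hmono, hdim, fun k hk => top_le_iff.mp (htopn ▸ hmono hk)⟩, fun k _ => rfl, ?_⟩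
  intro h hh
  constructor
  · intro hF
    by_contra hlt
    push Not at hlt
    have h1 := hF i hi (by omega)
    have h2 : (Matrix.diagonal d).mulVecLin (A i) ∈ G (h i) :=
      h1 (Submodule.mem_map_of_mem (hmem i i hi le_rfl))
    let φ : (Fin n → ℂ) →ₗ[ℂ] ℂ :=
      LinearMap.proj (R := ℂ) (φ := fun _ => ℂ) (⟨0, by omega⟩ : Fin n) -
        LinearMap.proj (R := ℂ) (φ := fun _ => ℂ) (⟨1, by omega⟩ : Fin n)
    have hφ : ∀ v, φ v = v ⟨0, by omega⟩ - v ⟨1, by omega⟩ := fun v => rfl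
    have h3 : G (h i) ≤ LinearMap.ker φ := by
      apply Submodule.span_le.mpr
      rintro _ ⟨m, ⟨hm1, hm2⟩, rfl⟩
      rw [SetLike.mem_coe, LinearMap.mem_ker, hφ, hA]
      split_ifs
      · simp only [stdVec_zero_apply]
        rw [if_neg (by omega), if_neg (by omega), sub_zero]
      · simp [stdVec_zero_apply]
      · simp only [stdVec_zero_apply]
        rw [if_neg (by omega), if_neg (by omega), sub_zero]
      · omega
      · omega
    have h4 := h3 h2
    rw [LinearMap.mem_ker, hφ, hAi] at h4
    simp [Matrix.mulVec_diagonal, stdVec_zero_apply] at h4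
    exact hd (sub_eq_zero.mp h4)
  · intro hji k hk1 hk2
    rw [Submodule.map_le_iff_le_comap]
    apply Submodule.span_le.mpr
    rintro _ ⟨m, ⟨hm1, hm2⟩, rfl⟩
    rw [SetLike.mem_coe, Submodule.mem_comap]
    change _ ∈ G (h k)
    have hkk := hh.2 k hk1 hk2
    by_cases hmi : m = i
    · subst hmi
      have hjk : j ≤ h k := hji.trans (hh.1.1 m k hi hm2 hk2)
      obtain ⟨c1, hc1⟩ := diag_stdVec d 1
      obtain ⟨c2, hc2⟩ := diag_stdVec d 2
      have : (Matrix.diagonal d).mulVecLin (A m) = c2 • A m + (c1 - c2) • A j := by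
        rw [hAi, hAj, map_add, hc1, hc2]
        module
      rw [this]
      exact add_mem (Submodule.smul_mem _ _ (hmem _ _ hm1 (by omega)))
        (Submodule.smul_mem _ _ (hmem _ _ (by omega) hjk))
    · have : ∃ p, A m = stdVec n p := by
        rw [hA, if_neg hmi]
        split_ifs <;> exact ⟨_, rfl⟩
      obtain ⟨p, hp⟩ := this
      obtain ⟨c, hc⟩ := diag_stdVec d p
      have h5 := hmem m (h k) hm1 (by omega)
      rw [hp] at h5 ⊢
      rw [hc]
      exact Submodule.smul_mem _ _ h5
end

section
/- Let 0 < j < n and let h be a strict Hessenberg function on {1,…,n} with h(j) = j; let h₁(i) = h(i) on {1,…,j} and h₂(i) = h(i+j) − j on {1,…,n−j}, and let N, N₁, N₂ be the regular nilpotent matrices of sizes n, j, n−j. Let ι₁ : ℂʲ → ℂⁿ and ι₂ : ℂ^{n−j} → ℂⁿ be the inclusions onto the first j and the last n−j coordinates. Given flags F¹ ∈ Hess(N₁,h₁) and F² ∈ Hess(N₂,h₂), define V_i = ι₁(F¹_i) for 0 ≤ i ≤ j and V_i = ι₁(ℂʲ) + ι₂(F²_{i−j}) for j < i ≤ n. Then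 V is a complete flag in ℂⁿ and V ∈ Hess(N,h). -/
open Matrix

/-- Inclusion of `ℂʲ` into `ℂⁿ` as the first `j` coordinates. -/
noncomputable def incl1 (n j : ℕ) : (Fin j → ℂ) →ₗ[ℂ] (Fin n → ℂ) where
  toFun v m := if h : m.1 < j then v ⟨m.1, h⟩ else 0
  map_add' u v := by funext m; by_cases h : m.1 < j <;> simp [h]
  map_smul' c v := by funext m; by_cases h : m.1 < j <;> simp [h]

/-- Inclusion of `ℂ^{n-j}` into `ℂⁿ` as the last `n - j` coordinates. -/
noncomputable def incl2 (n j : ℕ) : (Fin (n - j) → ℂ) →ₗ[ℂ] (Fin n → ℂ) where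
  toFun v m := if h : j ≤ m.1 then v ⟨m.1 - j, by have := m.isLt; omega⟩ else 0
  map_add' u v := by funext m; by_cases h : j ≤ m.1 <;> simp [h]
  map_smul' c v := by funext m; by_cases h : j ≤ m.1 <;> simp [h]

theorem aux_regNil_apply (n : ℕ) (v : Fin n → ℂ) (m : Fin n) :
    (regNil n).mulVecLin v m = if h : m.1 + 1 < n then v ⟨m.1 + 1, h⟩ else 0 := by
  simp only [Matrix.mulVecLin_apply, Matrix.mulVec, dotProduct, regNil, Matrix.of_apply]
  split_ifs with h
  · rw [Finset.sum_eq_single ⟨m.1 + 1, h⟩]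
    · simp
    · intro b _ hb
      rw [if_neg, zero_mul]
      intro e
      exact hb (Fin.ext e.symm)
    · simp
  · apply Finset.sum_eq_zero
    intro b _
    have := b.isLt
    rw [if_neg (by omega), zero_mul]

theorem aux_incl1_apply (n j : ℕ) (v : Fin j → ℂ) (m : Fin n) :
    incl1 n j v m = if h : m.1 < j then v ⟨m.1, h⟩ else 0 := rfl

theorem aux_incl2_apply (n j : ℕ) (v : Fin (n - j) → ℂ) (m : Fin n) :
    incl2 n j v m = if h : j ≤ m.1 then v ⟨m.1 - j, by have := m.isLt; omega⟩ else 0 := rfl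

theorem aux_incl1_inj {n j : ℕ} (hjn : j < n) : Function.Injective (incl1 n j) := by
  intro u v e
  funext k
  have := congrFun e ⟨k.1, by omega⟩
  simpa [aux_incl1_apply] using this

theorem aux_incl2_inj {n j : ℕ} : Function.Injective (incl2 n j) := by
  intro u v e
  funext k
  have := congrFun e ⟨k.1 + j, by omega⟩
  simpa [aux_incl2_apply] using this

theorem aux_mem_range {n j : ℕ} (hjn : j < n) (v : Fin n → ℂ)
    (hv : ∀ m : Fin n, j ≤ m.1 → v m = 0) : v ∈ LinearMap.range (incl1 n j) := by
  refine ⟨fun k => v ⟨k.1, by omega⟩, ?_⟩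
  funext m
  rw [aux_incl1_apply]
  split_ifs with h
  · rfl
  · exact (hv m (by omega)).symm

theorem aux_disj (n j : ℕ) :
    Disjoint (LinearMap.range (incl1 n j)) (LinearMap.range (incl2 n j)) := by
  rw [Submodule.disjoint_def]
  rintro x ⟨u, hu⟩ ⟨v, hv⟩
  funext m
  by_cases h : m.1 < j
  · rw [← hv, aux_incl2_apply, dif_neg (by omega)]; rfl
  · rw [← hu, aux_incl1_apply, dif_neg h]; rfl

theorem aux_N1 {n j : ℕ} (hjn : j < n) (v : Fin j → ℂ) :
    (regNil n).mulVecLin (incl1 n j v) = incl1 n j ((regNil j).mulVecLin v) := by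
  funext m
  rw [aux_regNil_apply, aux_incl1_apply]
  simp only [aux_regNil_apply, aux_incl1_apply]
  split_ifs <;> first | rfl | omega

theorem aux_N2 {n j : ℕ} (hjn : j < n) (v : Fin (n - j) → ℂ) :
    (regNil n).mulVecLin (incl2 n j v) - incl2 n j ((regNil (n - j)).mulVecLin v)
      ∈ LinearMap.range (incl1 n j) := by
  apply aux_mem_range hjn
  intro m hm
  rw [Pi.sub_apply, sub_eq_zero, aux_regNil_apply, aux_incl2_apply, dif_pos hm,
    aux_regNil_apply]
  simp only [aux_incl2_apply]
  split_ifs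
  · congr 1; apply Fin.ext; simp only; omega
  all_goals first | rfl | omega

/-- With `h(j) = j`, `h₁ = h|_{[1,j]}`, `h₂(i) = h(i+j) − j`, and flags
`F¹ ∈ Hess(N₁,h₁)`, `F² ∈ Hess(N₂,h₂)`, the sequence `Vᵢ = ι₁(F¹ᵢ)` for `i ≤ j` and
`Vᵢ = ι₁(ℂʲ) + ι₂(F²_{i−j})` for `j < i ≤ n` is a complete flag in `ℂⁿ` lying in `Hess(N,h)`. -/
theorem glued_flag_mem_hess {n j : ℕ} (hj0 : 0 < j) (hjn : j < n)
    (h : ℕ → ℕ) (hh : IsStrictHessFun n h) (hhj : h j = j)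
    (F1 : CompleteFlag j) (F2 : CompleteFlag (n - j))
    (hF1 : F1 ∈ Hess j (regNil j) h)
    (hF2 : F2 ∈ Hess (n - j) (regNil (n - j)) (fun i => h (i + j) - j)) :
    ∃ V : CompleteFlag n,
      (∀ i, i ≤ j → V.F i = (F1.F i).map (incl1 n j)) ∧
      (∀ i, j < i → i ≤ n →
        V.F i = LinearMap.range (incl1 n j) ⊔ (F2.F (i - j)).map (incl2 n j)) ∧
      V ∈ Hess n (regNil n) h := by
  have hz : F2.F 0 = ⊥ := Submodule.finrank_eq_zero.mp (F2.dim 0 (Nat.zero_le _))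
  have hdim : ∀ i, i ≤ n → Module.finrank ℂ
      ((F1.F i).map (incl1 n j) ⊔ (F2.F (i - j)).map (incl2 n j) : Submodule ℂ (Fin n → ℂ)) = i := by
    intro i hi
    have e := Submodule.finrank_sup_add_finrank_inf_eq
      ((F1.F i).map (incl1 n j)) ((F2.F (i - j)).map (incl2 n j))
    have d : (F1.F i).map (incl1 n j) ⊓ (F2.F (i - j)).map (incl2 n j) = ⊥ :=
      disjoint_iff.mp ((aux_disj n j).mono LinearMap.map_le_range LinearMap.map_le_range)
    rw [d, finrank_bot,
      ← (Submodule.equivMapOfInjective _ (aux_incl1_inj hjn) (F1.F i)).finrank_eq,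
      ← (Submodule.equivMapOfInjective _ aux_incl2_inj (F2.F (i - j))).finrank_eq,
      F2.dim (i - j) (by omega)] at e
    by_cases hij : i ≤ j
    · rw [F1.dim i hij] at e; omega
    · rw [F1.top i (by omega), finrank_top, Module.finrank_fin_fun] at e
      rw [F1.top i (by omega)]; omega
  refine ⟨⟨fun i => (F1.F i).map (incl1 n j) ⊔ (F2.F (i - j)).map (incl2 n j), ?_, hdim, ?_⟩,
    ?_, ?_, ?_⟩
  · intro a b hab
    exact sup_le_sup (Submodule.map_mono (F1.mono hab))
      (Submodule.map_mono (F2.mono (Nat.sub_le_sub_right hab j)))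
  · intro i hi
    have e := hdim n le_rfl
    rw [F1.top n hjn.le, F2.top (n - j) le_rfl] at e
    rw [F1.top i (by omega), F2.top (i - j) (by omega)]
    apply Submodule.eq_top_of_finrank_eq
    rw [e]; simp
  · intro i hi
    simp only
    rw [Nat.sub_eq_zero_of_le hi, hz, Submodule.map_bot, sup_bot_eq]
  · intro i hi _
    simp only
    rw [F1.top i hi.le, Submodule.map_top]
  · intro i hi hin
    simp only
    obtain ⟨⟨hm, hb⟩, hs⟩ := hh
    rw [Submodule.map_sup]
    apply sup_le
    · by_cases hij : i ≤ j
      · refine le_trans ?_ le_sup_left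
        rintro _ ⟨_, ⟨v, hv, rfl⟩, rfl⟩
        rw [aux_N1 hjn]
        exact Submodule.mem_map_of_mem (hF1 i hi hij (Submodule.mem_map_of_mem hv))
      · refine le_trans ?_ le_sup_left
        have := hs i hi hin
        rw [F1.top (h i) (by omega)]
        rintro _ ⟨_, ⟨v, hv, rfl⟩, rfl⟩
        rw [aux_N1 hjn]
        exact Submodule.mem_map_of_mem Submodule.mem_top
    · by_cases hij : i ≤ j
      · rw [Nat.sub_eq_zero_of_le hij, hz]
        simp
      · have := hs i hi hin
        rw [F1.top (h i) (by omega), Submodule.map_top]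
        rintro _ ⟨_, ⟨v, hv, rfl⟩, rfl⟩
        have h2 := hF2 (i - j) (by omega) (by omega) (Submodule.mem_map_of_mem hv)
        simp only [Nat.sub_add_cancel (le_of_not_ge hij)] at h2
        rw [← sub_add_cancel ((regNil n).mulVecLin (incl2 n j v))
          (incl2 n j ((regNil (n - j)).mulVecLin v))]
        exact Submodule.add_mem_sup (aux_N2 hjn v) (Submodule.mem_map_of_mem h2)
end
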